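/- arXiv:1704.08905 — 4 statements merged into one kernel-verified Lean document; each statement's English description precedes it below -/
import Mathlib

section
/- For every L ≥ L0 there exists ρ̄(L) ∈ (0,ρ0) with the following property: for every ρ ∈ (0,ρ̄(L)), if h ∈ X_{L,ρ} satisfies 1/2 ≤ Q[h](y) ≤ 3/2 for all y < Lρ and there exists a constant k1 ∈ (1/2, 3/2) with h(x) = k1·e^{−ψ_ρ[h](x)} + R̃[h](x) for all x < Lρ, then (1/4)·e^{−ψ_ρ[h](x)} ≤ h(x) ≤ 2·e^{−ψ_ρ[h](x)} for all x < Lρ. -/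
open Set MeasureTheory Filter

/-- The weight exponent ω. -/
noncomputable def omegaFn (m L ρ x : ℝ) : ℝ :=
  if x ≤ -(L*ρ) then m/ρ*(x+L*ρ) else if x < L*ρ then 0 else -(1/2)*(x - L*ρ)

/-- The norm on the space X_{L,ρ}. -/
noncomputable def normX (m L ρ : ℝ) (h : ℝ → ℝ) : ℝ :=
  ⨆ x : ℝ, |h x| * Real.exp (-(omegaFn m L ρ x))

/-- Membership in the space X_{L,ρ}. -/
def memX (a m L ρ : ℝ) (h : ℝ → ℝ) : Prop :=
  ContinuousOn h {x : ℝ | x ≠ L*ρ} ∧ (∫ x : ℝ, h x) = 1 ∧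
  (1/ρ) * (∫ x : ℝ, Real.exp (-(a/ρ)*x) * h x) = 1/(1+ρ) ∧
  ∀ x : ℝ, |h x| ≤ 2 * Real.exp (omegaFn m L ρ x)

/-- The hypotheses on the coagulation kernel K. -/
def KernelHyp (K : ℝ → ℝ → ℝ) (γ a K0 δ : ℝ) : Prop :=
  γ < 1 ∧ a = 1 - γ ∧
  ContinuousOn (fun p : ℝ × ℝ => K p.1 p.2) (Ioi 0 ×ˢ Ioi 0) ∧
  (∀ x y : ℝ, 0 < x → 0 < y → 0 ≤ K x y) ∧
  (∀ x y : ℝ, 0 < x → 0 < y → K x y = K y x) ∧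
  (∀ x y α : ℝ, 0 < x → 0 < y → 0 < α → K (α*x) (α*y) = α ^ γ * K x y) ∧
  0 < K0 ∧ δ ∈ Ioo 0 (min 1 a) ∧
  ∀ x ∈ Ioo (0:ℝ) 2, |x ^ a * K x 1 - 1| ≤ K0 * x ^ δ

/-- The hypotheses on the fixed parameters m, L0, ρ0. -/
def ParamHyp (a m L0 ρ0 : ℝ) : Prop :=
  max (a+1) (3*a) < m ∧ (1/a) * Real.log (4*m) < L0 ∧ ρ0 ∈ Ioo (0:ℝ) 1

/-- The function Q[h]. -/
noncomputable def Qfun (K : ℝ → ℝ → ℝ) (a ρ : ℝ) (h : ℝ → ℝ) (y : ℝ) : ℝ :=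
  ∫ z : ℝ, Real.exp (a/ρ*(y-z)) * K (Real.exp ((y-z)/ρ)) 1 * h z

/-- The function ψ_ρ[h]. -/
noncomputable def psiFn (K : ℝ → ℝ → ℝ) (a L ρ : ℝ) (h : ℝ → ℝ) (x : ℝ) : ℝ :=
  (1/ρ) * ∫ y in Ioo x (L*ρ), Real.exp (-(a/ρ)*y) * Qfun K a ρ h y

/-- The remainder R[h]. -/
noncomputable def Rfun (K : ℝ → ℝ → ℝ) (a L ρ : ℝ) (h : ℝ → ℝ) (x : ℝ) : ℝ :=
  if x < L*ρ then
    -(1/ρ) * ∫ y in Iio x, ∫ z in Iio (x + ρ * Real.log (1 - Real.exp ((y-x)/ρ))),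
      Real.exp (-(a/ρ)*z) * K (Real.exp ((y-z)/ρ)) 1 * h y * h z
  else
    -(1/ρ) * (∫ y in Ioi x, Real.exp (-(a/ρ)*y) * h y) * (∫ z in Ioi x, h z)
    + (1/ρ) * (∫ y in Iio x, ∫ z in Ioi x,
        (Real.exp (-(a/ρ)*z) * K (Real.exp ((y-z)/ρ)) 1 - Real.exp (-(a/ρ)*y)) * h y * h z)
    + (1/ρ) * (∫ y in Iio x, ∫ z in Ioo (x + ρ * Real.log (1 - Real.exp ((y-x)/ρ))) x,
        Real.exp (-(a/ρ)*z) * K (Real.exp ((y-z)/ρ)) 1 * h y * h z)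

/-- The remainder R̃[h]. -/
noncomputable def Rtil (K : ℝ → ℝ → ℝ) (a L ρ : ℝ) (h : ℝ → ℝ) (x : ℝ) : ℝ :=
  if x < L*ρ then
    Rfun K a L ρ h x - (1/ρ) * ∫ y in Ioo x (L*ρ),
      Real.exp (-(psiFn K a L ρ h x - psiFn K a L ρ h y)) * Real.exp (-(a/ρ)*y) *
        Qfun K a ρ h y * Rfun K a L ρ h y
  else
    Rfun K a L ρ h x - (1/(1+ρ)) * ∫ y in Ioo (L*ρ) x,
      Real.exp ((y-x)/(1+ρ)) * Rfun K a L ρ h y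

/-- Equation (E) in exponential variables. -/
def solvesE (K : ℝ → ℝ → ℝ) (a ρ : ℝ) (h : ℝ → ℝ) : Prop :=
  ∀ x : ℝ, h x = (1/ρ) * ∫ y in Iio x,
    ∫ z in Ioi (x + ρ * Real.log (1 - Real.exp ((y-x)/ρ))),
      Real.exp (-(a/ρ)*z) * K (Real.exp ((y-z)/ρ)) 1 * h y * h z

/-- The decay exponent λ. -/
noncomputable def lamFn (K : ℝ → ℝ → ℝ) (a L ρ : ℝ) (h : ℝ → ℝ) (x : ℝ) : ℝ :=
  if x < L*ρ then -psiFn K a L ρ h x else -(1/2)*(x - L*ρ)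

/-- The remainder H. -/
noncomputable def Hfun (K : ℝ → ℝ → ℝ) (a ρ : ℝ) (h : ℝ → ℝ) (x : ℝ) : ℝ :=
  (1/ρ) * (∫ y in Iio x, ∫ z in Ioi (x + ρ * Real.log (1 - Real.exp ((y-x)/ρ))),
      Real.exp (-(a/ρ)*z) * K (Real.exp ((y-z)/ρ)) 1 * h y * h z)
    - (ρ/(1+ρ)) * h x - (1/(1+ρ)) * ∫ z in Ioi x, h z

lemma aux_small (K : ℝ → ℝ → ℝ) (γ a K0 δ : ℝ) (hK : KernelHyp K γ a K0 δ) (t : ℝ) (ht : t ≤ 0) :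
    K (Real.exp t) 1 ≤ (1 + K0) * Real.exp (-a*t) := by
  obtain ⟨_, _, _, _, _, _, hK0, hδ, hb⟩ := hK
  have h1 : Real.exp t ≤ 1 := Real.exp_le_one_iff.2 ht
  have h2 := hb (Real.exp t) ⟨Real.exp_pos _, by linarith⟩
  have h3 : (Real.exp t) ^ δ ≤ 1 := Real.rpow_le_one (Real.exp_pos _).le h1 hδ.1.le
  have h4 : (Real.exp t) ^ a * K (Real.exp t) 1 ≤ 1 + K0 := by
    have := (abs_le.1 h2).2
    nlinarith
  have h5 : (Real.exp t) ^ a = Real.exp (a*t) := by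
    rw [← Real.exp_mul, mul_comm]
  rw [h5] at h4
  have h6 : Real.exp (-a*t) * Real.exp (a*t) = 1 := by
    rw [← Real.exp_add]; simp
  calc K (Real.exp t) 1 = Real.exp (-a*t) * (Real.exp (a*t) * K (Real.exp t) 1) := by
        rw [← mul_assoc, h6, one_mul]
    _ ≤ Real.exp (-a*t) * (1 + K0) := by gcongr
    _ = _ := mul_comm _ _

lemma aux_large (K : ℝ → ℝ → ℝ) (γ a K0 δ : ℝ) (hK : KernelHyp K γ a K0 δ) (t : ℝ) (ht : 0 ≤ t) :
    K (Real.exp t) 1 ≤ (1 + K0) * Real.exp t := by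
  have h1 := aux_small K γ a K0 δ hK (-t) (by linarith)
  obtain ⟨_, ha, _, _, hs, hh, hK0, hδ, hb⟩ := hK
  have h2 := hh 1 (Real.exp (-t)) (Real.exp t) one_pos (Real.exp_pos _) (Real.exp_pos _)
  rw [← Real.exp_add, hs 1 _ one_pos (Real.exp_pos _)] at h2
  simp only [mul_one, add_neg_cancel, Real.exp_zero] at h2
  rw [h2, ← Real.exp_mul]
  calc Real.exp (t*γ) * K (Real.exp (-t)) 1 ≤ Real.exp (t*γ) * ((1 + K0) * Real.exp (-a * -t)) := by gcongr
    _ = (1+K0) * (Real.exp (t*γ) * Real.exp (-a * -t)) := by ring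
    _ = _ := by rw [← Real.exp_add]; congr 2; rw [ha]; ring

lemma aux_kern (K : ℝ → ℝ → ℝ) (γ a K0 δ : ℝ) (hK : KernelHyp K γ a K0 δ) (ρ : ℝ) (hρ : 0 < ρ)
    (y z : ℝ) : |Real.exp (-(a/ρ)*z) * K (Real.exp ((y-z)/ρ)) 1| ≤
      (1+K0) * (Real.exp (-(a+1) * (min y z/ρ)) * Real.exp (max y z/ρ)) := by
  have hpos : 0 ≤ K (Real.exp ((y-z)/ρ)) 1 := hK.2.2.2.1 _ _ (Real.exp_pos _) one_pos
  have hK0 : 0 < K0 := hK.2.2.2.2.2.2.1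
  rw [abs_of_nonneg (by positivity)]
  rcases le_total y z with h | h
  · rw [min_eq_left h, max_eq_right h]
    have h1 := aux_small K γ a K0 δ hK ((y-z)/ρ) (div_nonpos_of_nonpos_of_nonneg (by linarith) hρ.le)
    calc _ ≤ Real.exp (-(a/ρ)*z) * ((1 + K0) * Real.exp (-a*((y-z)/ρ))) := by gcongr
      _ = (1+K0) * (Real.exp (-(a/ρ)*z) * Real.exp (-a*((y-z)/ρ))) := by ring
      _ ≤ _ := by
        rw [← Real.exp_add, ← Real.exp_add]
        refine mul_le_mul_of_nonneg_left (Real.exp_le_exp.2 ?_) (by positivity)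
        have : y/ρ ≤ z/ρ := by gcongr
        have e : -(a/ρ)*z + -a*((y-z)/ρ) = -a*(y/ρ) := by ring
        rw [e]; nlinarith
  · rw [min_eq_right h, max_eq_left h]
    have h1 := aux_large K γ a K0 δ hK ((y-z)/ρ) (div_nonneg (by linarith) hρ.le)
    calc _ ≤ Real.exp (-(a/ρ)*z) * ((1 + K0) * Real.exp ((y-z)/ρ)) := by gcongr
      _ = (1+K0) * (Real.exp (-(a/ρ)*z) * Real.exp ((y-z)/ρ)) := by ring
      _ = _ := by
        rw [← Real.exp_add, ← Real.exp_add]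
        congr 2; ring

lemma aux_exp_int (c x : ℝ) (hc : 0 < c) :
    IntegrableOn (fun z => Real.exp (c*z)) (Iio x) ∧
    ∫ z in Iio x, Real.exp (c*z) = Real.exp (c*x)/c := by
  refine ⟨(integrableOn_exp_mul_Iic hc x).mono_set Iio_subset_Iic_self, ?_⟩
  rw [← integral_Iic_eq_integral_Iio, integral_exp_mul_Iic hc]

lemma aux_R (K : ℝ → ℝ → ℝ) (γ a K0 δ : ℝ) (hK : KernelHyp K γ a K0 δ) (m L ρ : ℝ) (hρ : 0 < ρ)
    (hm : a + 1 < m) (h : ℝ → ℝ) (x W : ℝ) (hx : x < L*ρ)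
    (hW : ∀ t < x, |h t| ≤ W) (hh : ∀ t < x, |h t| ≤ 2 * Real.exp (m*(t/ρ+L))) :
    |Rfun K a L ρ h x| ≤
      ρ * (4*(1+K0)*Real.exp (m*L)/(m-a-1)) * W * Real.exp ((m-a)*(x/ρ)) := by
  have hK0 : 0 < K0 := hK.2.2.2.2.2.2.1
  have hW0 : 0 ≤ W := (abs_nonneg _).trans (hW (x-1) (by linarith))
  obtain ⟨p, hp⟩ : ∃ p, p = m-a-1 := ⟨_, rfl⟩
  have hp0 : 0 < p := by linarith
  obtain ⟨A, hA⟩ : ∃ A, A = 2*(1+K0)*Real.exp (m*L)*W := ⟨_, rfl⟩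
  have hA0 : 0 ≤ A := by rw [hA]; positivity
  -- pointwise bound
  have key : ∀ y < x, ∀ z < x,
      ‖Real.exp (-(a/ρ)*z) * K (Real.exp ((y-z)/ρ)) 1 * h y * h z‖ ≤
        A * Real.exp (p/ρ*y) * Real.exp (1/ρ*z) + A * Real.exp (1/ρ*y) * Real.exp (p/ρ*z) := by
    intro y hy z hz
    have h1 := aux_kern K γ a K0 δ hK ρ hρ y z
    have h2 : |h y| * |h z| ≤ 2 * Real.exp (m*(min y z/ρ+L)) * W := by
      rcases le_total y z with hyz | hyz
      · rw [min_eq_left hyz]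
        exact mul_le_mul (hh y hy) (hW z hz) (abs_nonneg _) (by positivity)
      · rw [min_eq_right hyz, mul_comm]
        exact mul_le_mul (hh z hz) (hW y hy) (abs_nonneg _) (by positivity)
    rw [mul_assoc, norm_mul, norm_mul (h y), Real.norm_eq_abs, Real.norm_eq_abs, Real.norm_eq_abs]
    calc _ ≤ ((1+K0) * (Real.exp (-(a+1) * (min y z/ρ)) * Real.exp (max y z/ρ))) *
          (2 * Real.exp (m*(min y z/ρ+L)) * W) := by gcongr
      _ = A * (Real.exp (p/ρ*min y z) * Real.exp (1/ρ*max y z)) := by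
        have e1 : Real.exp (m*(min y z/ρ+L)) = Real.exp (m*L) * Real.exp (m*(min y z/ρ)) := by
          rw [← Real.exp_add]; congr 1; ring
        have e2 : Real.exp (p/ρ*min y z) = Real.exp (-(a+1) * (min y z/ρ)) * Real.exp (m*(min y z/ρ)) := by
          rw [← Real.exp_add]; congr 1; rw [hp]; ring
        have e3 : 1/ρ*max y z = max y z/ρ := by ring
        rw [e1, e2, e3, hA]; ring
      _ ≤ _ := by
        rcases le_total y z with hyz | hyz
        · rw [min_eq_left hyz, max_eq_right hyz, ← mul_assoc]
          have : 0 ≤ A * Real.exp (1/ρ*y) * Real.exp (p/ρ*z) := by positivity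
          linarith
        · rw [min_eq_right hyz, max_eq_left hyz]
          have : 0 ≤ A * Real.exp (p/ρ*y) * Real.exp (1/ρ*z) := by positivity
          linarith
  obtain ⟨i1, v1⟩ := aux_exp_int (1/ρ) x (by positivity)
  obtain ⟨i2, v2⟩ := aux_exp_int (p/ρ) x (by positivity)
  have inner : ∀ y < x,
      ‖∫ z in Iio (x + ρ * Real.log (1 - Real.exp ((y-x)/ρ))),
        Real.exp (-(a/ρ)*z) * K (Real.exp ((y-z)/ρ)) 1 * h y * h z‖ ≤
      A * Real.exp (p/ρ*y) * (Real.exp (1/ρ*x)/(1/ρ)) + A * Real.exp (1/ρ*y) * (Real.exp (p/ρ*x)/(p/ρ)) := by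
    intro y hy
    have hb : x + ρ * Real.log (1 - Real.exp ((y-x)/ρ)) ≤ x := by
      have h1 : Real.exp ((y-x)/ρ) < 1 := by
        rw [Real.exp_lt_one_iff]; exact div_neg_of_neg_of_pos (by linarith) hρ
      have h2 := Real.exp_pos ((y-x)/ρ)
      have : Real.log (1 - Real.exp ((y-x)/ρ)) ≤ 0 := Real.log_nonpos (by linarith) (by linarith)
      nlinarith
    generalize x + ρ * Real.log (1 - Real.exp ((y-x)/ρ)) = b at hb
    have ig : IntegrableOn (fun z => A * Real.exp (p/ρ*y) * Real.exp (1/ρ*z) + A * Real.exp (1/ρ*y) * Real.exp (p/ρ*z)) (Iio x) :=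
      (i1.const_mul _).add (i2.const_mul _)
    have sub : Iio b ⊆ Iio x := Iio_subset_Iio hb
    calc _ ≤ ∫ z in Iio b, (A * Real.exp (p/ρ*y) * Real.exp (1/ρ*z) + A * Real.exp (1/ρ*y) * Real.exp (p/ρ*z)) := by
          refine norm_integral_le_of_norm_le (ig.mono_set sub) ?_
          refine (ae_restrict_iff' measurableSet_Iio).2 (ae_of_all _ fun z hz => ?_)
          exact key y hy z (sub hz)
      _ ≤ ∫ z in Iio x, (A * Real.exp (p/ρ*y) * Real.exp (1/ρ*z) + A * Real.exp (1/ρ*y) * Real.exp (p/ρ*z)) := by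
          refine setIntegral_mono_set ig (ae_of_all _ fun z => ?_) (LE.le.eventuallyLE sub)
          simp only [Pi.zero_apply]; positivity
      _ = _ := by
          rw [integral_add (i1.const_mul _) (i2.const_mul _), integral_const_mul, integral_const_mul, v1, v2]
  have outer : ‖∫ y in Iio x, ∫ z in Iio (x + ρ * Real.log (1 - Real.exp ((y-x)/ρ))),
        Real.exp (-(a/ρ)*z) * K (Real.exp ((y-z)/ρ)) 1 * h y * h z‖ ≤
      A * (Real.exp (1/ρ*x)/(1/ρ)) * (Real.exp (p/ρ*x)/(p/ρ))
       + A * (Real.exp (p/ρ*x)/(p/ρ)) * (Real.exp (1/ρ*x)/(1/ρ)) := by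
    calc _ ≤ ∫ y in Iio x, (A * (Real.exp (1/ρ*x)/(1/ρ)) * Real.exp (p/ρ*y) + A * (Real.exp (p/ρ*x)/(p/ρ)) * Real.exp (1/ρ*y)) := by
          refine norm_integral_le_of_norm_le ((i2.const_mul _).add (i1.const_mul _)) ?_
          refine (ae_restrict_iff' measurableSet_Iio).2 (ae_of_all _ fun y hy => ?_)
          refine (inner y hy).trans (le_of_eq ?_)
          ring
      _ = _ := by
          rw [integral_add (i2.const_mul _) (i1.const_mul _), integral_const_mul, integral_const_mul, v1, v2]
  rw [Rfun, if_pos hx, abs_mul, abs_neg, abs_of_pos (by positivity : 0 < 1/ρ)]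
  rw [Real.norm_eq_abs] at outer
  refine (mul_le_mul_of_nonneg_left outer (by positivity)).trans (le_of_eq ?_)
  have e : Real.exp ((m-a)*(x/ρ)) = Real.exp (1/ρ*x) * Real.exp (p/ρ*x) := by
    rw [← Real.exp_add]; congr 1; rw [hp]; ring
  rw [e, hA, ← hp]
  field_simp
  ring

lemma aux_Q (K : ℝ → ℝ → ℝ) (γ a K0 δ : ℝ) (hK : KernelHyp K γ a K0 δ) (m L ρ : ℝ)
    (h : ℝ → ℝ) (hh : memX a m L ρ h) : StronglyMeasurable (Qfun K a ρ h) := by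
  have hm : Measurable h := by
    apply measurable_of_continuousOn_compl_singleton (L*ρ)
    exact hh.1
  have hc : Continuous (fun t : ℝ => K (Real.exp t) 1) := by
    have := hK.2.2.1
    exact this.comp_continuous (f := fun t : ℝ => (Real.exp t, (1:ℝ))) (by fun_prop)
      (fun t => ⟨Real.exp_pos _, by simp⟩)
  have : StronglyMeasurable (fun p : ℝ × ℝ =>
      Real.exp (a/ρ*(p.1-p.2)) * K (Real.exp ((p.1-p.2)/ρ)) 1 * h p.2) := by
    have h1 : Continuous (fun p : ℝ × ℝ => Real.exp (a/ρ*(p.1-p.2)) * K (Real.exp ((p.1-p.2)/ρ)) 1) := by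
      have := hc.comp (f := fun p : ℝ × ℝ => (p.1-p.2)/ρ) (by fun_prop)
      exact (by fun_prop : Continuous fun p : ℝ × ℝ => Real.exp (a/ρ*(p.1-p.2))).mul this
    exact (h1.measurable.mul (hm.comp measurable_snd)).stronglyMeasurable
  exact this.integral_prod_right

lemma aux_psi (K : ℝ → ℝ → ℝ) (a L ρ : ℝ) (hρ : 0 < ρ) (ha : 0 < a)
    (h : ℝ → ℝ) (hQm : StronglyMeasurable (Qfun K a ρ h))
    (hQ : ∀ y : ℝ, y < L*ρ → Qfun K a ρ h y ∈ Icc (1/2:ℝ) (3/2)) (x y : ℝ) (hxy : x ≤ y)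
    (hy : y < L*ρ) :
    (y-x)/ρ * (Real.exp (-(a/ρ)*y)/2) ≤ psiFn K a L ρ h x - psiFn K a L ρ h y := by
  have hint : IntegrableOn (fun y => Real.exp (-(a/ρ)*y) * Qfun K a ρ h y) (Ioo x (L*ρ)) := by
    refine IntegrableOn.of_bound (C := Real.exp (-(a/ρ)*x) * (3/2)) measure_Ioo_lt_top ?_ ?_
    · exact ((by fun_prop : Continuous fun y => Real.exp (-(a/ρ)*y)).stronglyMeasurable.mul
        hQm).aestronglyMeasurable
    · refine (ae_restrict_iff' measurableSet_Ioo).2 (ae_of_all _ fun t ht => ?_)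
      have := hQ t ht.2
      rw [norm_mul, Real.norm_eq_abs, Real.norm_eq_abs, Real.abs_exp, abs_of_nonneg (by linarith [this.1])]
      have h1 : -(a/ρ)*t ≤ -(a/ρ)*x := by
        have : 0 < a/ρ := by positivity
        nlinarith [ht.1]
      exact mul_le_mul (Real.exp_le_exp.2 h1) this.2 (by linarith [this.1]) (Real.exp_pos _).le
  have hun : Ioo x (L*ρ) = Ioc x y ∪ Ioo y (L*ρ) := (Ioc_union_Ioo_eq_Ioo hxy hy).symm
  have s1 : Ioc x y ⊆ Ioo x (L*ρ) := hun ▸ subset_union_left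
  have s2 : Ioo y (L*ρ) ⊆ Ioo x (L*ρ) := hun ▸ subset_union_right
  have hd : Disjoint (Ioc x y) (Ioo y (L*ρ)) := by
    rw [Set.disjoint_left]; intro t h1 h2; exact absurd h1.2 (not_le.2 h2.1)
  have e : psiFn K a L ρ h x - psiFn K a L ρ h y =
      (1/ρ) * ∫ t in Ioc x y, Real.exp (-(a/ρ)*t) * Qfun K a ρ h t := by
    unfold psiFn
    rw [hun, setIntegral_union hd measurableSet_Ioo (hint.mono_set s1) (hint.mono_set s2)]
    ring
  have lb : (y-x) * (Real.exp (-(a/ρ)*y)/2) ≤ ∫ t in Ioc x y, Real.exp (-(a/ρ)*t) * Qfun K a ρ h t := by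
    have : ∫ t in Ioc x y, (Real.exp (-(a/ρ)*y)/2) = (y-x) * (Real.exp (-(a/ρ)*y)/2) := by
      simp [hxy]
    rw [← this]
    refine setIntegral_mono_on (by simp) (hint.mono_set s1) measurableSet_Ioc fun t ht => ?_
    have h2 := (hQ t (s1 ht).2).1
    have h1 : -(a/ρ)*y ≤ -(a/ρ)*t := by
      have : 0 < a/ρ := by positivity
      nlinarith [ht.2]
    calc Real.exp (-(a/ρ)*y)/2 = Real.exp (-(a/ρ)*y) * (1/2) := by ring
      _ ≤ _ := by gcongr
  rw [e]
  calc _ = (1/ρ) * ((y-x) * (Real.exp (-(a/ρ)*y)/2)) := by ring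
    _ ≤ _ := by gcongr

lemma aux_Rtil (K : ℝ → ℝ → ℝ) (γ a K0 δ : ℝ) (hK : KernelHyp K γ a K0 δ) (m L ρ : ℝ) (hρ : 0 < ρ)
    (ha : 0 < a) (hm : a + 1 < m) (hm2 : 2*a < m) (h w : ℝ → ℝ) (C1 : ℝ)
    (hC1 : C1 = 4*(1+K0)*Real.exp (m*L)/(m-a-1))
    (hQ : ∀ y : ℝ, y < L*ρ → Qfun K a ρ h y ∈ Icc (1/2:ℝ) (3/2))
    (hw : ∀ x y, x ≤ y → y < L*ρ → w x ≤ w y)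
    (hw2 : ∀ x y, x ≤ y → y < L*ρ →
      Real.exp (-(psiFn K a L ρ h x - psiFn K a L ρ h y)) * w y ≤ w x)
    (hhw : ∀ x, x < L*ρ → |h x| ≤ 2 * w x)
    (hh : ∀ t < L*ρ, |h t| ≤ 2 * Real.exp (m*(t/ρ+L))) (x : ℝ) (hx : x < L*ρ) :
    |Rtil K a L ρ h x| ≤
      ρ * (C1 * (Real.exp ((m-a)*L) + 3/2*Real.exp ((m-2*a)*L)/(m-2*a))) * (2 * w x) := by
  have hK0 : 0 < K0 := hK.2.2.2.2.2.2.1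
  have hC0 : 0 < C1 := by
    rw [hC1]; have : 0 < m-a-1 := by linarith
    positivity
  have hw0 : ∀ y, y < L*ρ → 0 ≤ w y := fun y hy => by
    have := (abs_nonneg _).trans (hhw y hy); linarith
  have hR : ∀ y, y < L*ρ → |Rfun K a L ρ h y| ≤ ρ * C1 * (2 * w y) * Real.exp ((m-a)*(y/ρ)) := by
    intro y hy
    rw [hC1]
    refine aux_R K γ a K0 δ hK m L ρ hρ hm h y (2 * w y) hy (fun t ht => ?_) (fun t ht => hh t (ht.trans hy))
    have := hw t y ht.le hy
    linarith [hhw t (ht.trans hy)]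
  have hq : 0 < m - 2*a := by linarith
  obtain ⟨i1, v1⟩ := aux_exp_int ((m-2*a)/ρ) (L*ρ) (by positivity)
  have hI : ‖∫ y in Ioo x (L*ρ),
      Real.exp (-(psiFn K a L ρ h x - psiFn K a L ρ h y)) * Real.exp (-(a/ρ)*y) *
        Qfun K a ρ h y * Rfun K a L ρ h y‖ ≤
      (3/2 * ρ * C1 * (2 * w x)) * (Real.exp ((m-2*a)*L) / ((m-2*a)/ρ)) := by
    calc _ ≤ ∫ y in Ioo x (L*ρ), (3/2 * ρ * C1 * (2 * w x)) * Real.exp ((m-2*a)/ρ*y) := by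
          refine norm_integral_le_of_norm_le ((i1.mono_set Ioo_subset_Iio_self).const_mul _) ?_
          refine (ae_restrict_iff' measurableSet_Ioo).2 (ae_of_all _ fun y hy => ?_)
          have q := hQ y hy.2
          have r := hR y hy.2
          have w2 := hw2 x y hy.1.le hy.2
          rw [norm_mul, norm_mul, norm_mul, Real.norm_eq_abs, Real.norm_eq_abs, Real.norm_eq_abs,
            Real.norm_eq_abs, Real.abs_exp, Real.abs_exp, abs_of_nonneg (by linarith [q.1] : 0 ≤ Qfun K a ρ h y)]
          have q2 := q.2
          have q0 : 0 ≤ Qfun K a ρ h y := by linarith [q.1]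
          set E := Real.exp (-(psiFn K a L ρ h x - psiFn K a L ρ h y)) with hE
          have hE0 : 0 < E := Real.exp_pos _
          have wy := hw0 y hy.2
          calc E * Real.exp (-(a/ρ)*y) * Qfun K a ρ h y * |Rfun K a L ρ h y|
              ≤ E * Real.exp (-(a/ρ)*y) * (3/2) * (ρ * C1 * (2 * w y) * Real.exp ((m-a)*(y/ρ))) := by
                apply mul_le_mul _ r (abs_nonneg _) (by positivity)
                exact mul_le_mul_of_nonneg_left q2 (by positivity)
            _ = (3/2 * ρ * C1 * 2) * (E * w y) * (Real.exp (-(a/ρ)*y) * Real.exp ((m-a)*(y/ρ))) := by ring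
            _ ≤ (3/2 * ρ * C1 * 2) * w x * (Real.exp (-(a/ρ)*y) * Real.exp ((m-a)*(y/ρ))) := by gcongr
            _ = _ := by
                rw [← Real.exp_add]
                have : -(a/ρ)*y + (m-a)*(y/ρ) = (m-2*a)/ρ*y := by ring
                rw [this]; ring
      _ ≤ ∫ y in Iio (L*ρ), (3/2 * ρ * C1 * (2 * w x)) * Real.exp ((m-2*a)/ρ*y) := by
          refine setIntegral_mono_set (i1.const_mul _) (ae_of_all _ fun z => ?_)
            (LE.le.eventuallyLE Ioo_subset_Iio_self)
          have := hw0 x hx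
          simp only [Pi.zero_apply]; positivity
      _ = _ := by
          rw [integral_const_mul, v1]
          have : (m-2*a)/ρ*(L*ρ) = (m-2*a)*L := by field_simp
          rw [this]
  rw [Rtil, if_pos hx]
  refine (abs_sub _ _).trans ?_
  rw [abs_mul, abs_of_pos (by positivity : 0 < 1/ρ)]
  rw [Real.norm_eq_abs] at hI
  have hx' : x/ρ ≤ L := by rw [div_le_iff₀ hρ]; exact hx.le
  have h1 : |Rfun K a L ρ h x| ≤ ρ * C1 * (2 * w x) * Real.exp ((m-a)*L) := by
    refine (hR x hx).trans ?_
    have := hw0 x hx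
    have : 0 ≤ m-a := by linarith
    gcongr
  have h2 := mul_le_mul_of_nonneg_left hI (by positivity : 0 ≤ 1/ρ)
  refine (add_le_add h1 h2).trans (le_of_eq ?_)
  field_simp

/-- decay of the solution at -∞ (Theorem 5.1 of the paper). -/
theorem decay_at_minus_infinity
    (K : ℝ → ℝ → ℝ) (γ a K0 δ m L0 ρ0 : ℝ)
    (hK : KernelHyp K γ a K0 δ) (hP : ParamHyp a m L0 ρ0) :
    ∀ L : ℝ, L0 ≤ L → ∃ ρbar ∈ Ioo (0:ℝ) ρ0, ∀ ρ ∈ Ioo (0:ℝ) ρbar,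
      ∀ h : ℝ → ℝ, memX a m L ρ h →
      (∀ y : ℝ, y < L*ρ → Qfun K a ρ h y ∈ Icc (1/2:ℝ) (3/2)) →
      (∃ k1 ∈ Ioo (1/2:ℝ) (3/2), ∀ x : ℝ, x < L*ρ →
        h x = k1 * Real.exp (-psiFn K a L ρ h x) + Rtil K a L ρ h x) →
      ∀ x : ℝ, x < L*ρ →
        (1/4) * Real.exp (-psiFn K a L ρ h x) ≤ h x ∧
        h x ≤ 2 * Real.exp (-psiFn K a L ρ h x) := by
  obtain ⟨hm, hL0, hρ0⟩ := hP
  have hδ := hK.2.2.2.2.2.2.2.1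
  have hK0 : 0 < K0 := hK.2.2.2.2.2.2.1
  have ha : 0 < a := lt_of_lt_of_le (hδ.1.trans hδ.2) (min_le_right _ _)
  have hm1 : a + 1 < m := lt_of_le_of_lt (le_max_left _ _) hm
  have hm2 : 3*a < m := lt_of_le_of_lt (le_max_right _ _) hm
  intro L hL
  have hlog : Real.log (4*m) < a*L := by
    have h1 : (1/a) * Real.log (4*m) < L := lt_of_lt_of_le hL0 hL
    have h2 := mul_lt_mul_of_pos_left h1 ha
    rwa [← mul_assoc, mul_one_div_cancel ha.ne', one_mul] at h2
  have hLpos : 0 < L := by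
    have : 0 < Real.log (4*m) := Real.log_pos (by linarith)
    exact pos_of_mul_pos_right (this.trans hlog) ha.le
  have h4m : 4*m < Real.exp (a*L) := (Real.log_lt_iff_lt_exp (by linarith)).1 hlog
  obtain ⟨C1, hC1⟩ : ∃ C1, C1 = 4*(1+K0)*Real.exp (m*L)/(m-a-1) := ⟨_, rfl⟩
  obtain ⟨C, hC⟩ : ∃ C, C = C1 * (Real.exp ((m-a)*L) + 3/2*Real.exp ((m-2*a)*L)/(m-2*a)) := ⟨_, rfl⟩
  have hC0 : 0 < C := by
    have : 0 < m-a-1 := by linarith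
    have : 0 < m-2*a := by linarith
    have : 0 < C1 := by rw [hC1]; positivity
    rw [hC]; positivity
  refine ⟨min (ρ0/2) (1/(8*C)), ⟨lt_min (by linarith [hρ0.1]) (by positivity),
    (min_le_left _ _).trans_lt (by linarith [hρ0.1])⟩, ?_⟩
  rintro ρ ⟨hρ, hρb⟩ h hX hQ ⟨k1, hk1, hE⟩
  have hρC : ρ * C < 1/8 := by
    have := lt_of_lt_of_le hρb (min_le_right _ _)
    rw [lt_div_iff₀ (by positivity)] at this
    linarith
  have hpsi := aux_psi K a L ρ hρ ha h (aux_Q K γ a K0 δ hK m L ρ h hX) hQ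
  have hψ : ∀ x y, x ≤ y → y < L*ρ → psiFn K a L ρ h y ≤ psiFn K a L ρ h x := by
    intro x y hxy hy
    have h1 := hpsi x y hxy hy
    have : 0 ≤ y - x := by linarith
    have : 0 ≤ (y-x)/ρ * (Real.exp (-(a/ρ)*y)/2) := by positivity
    linarith
  have hLρ : 0 < L*ρ := by positivity
  have hmρ : 0 < m/ρ := div_pos (by linarith) hρ
  have hωmono : ∀ x y, x ≤ y → y < L*ρ → omegaFn m L ρ x ≤ omegaFn m L ρ y := by
    intro x y hxy hy
    unfold omegaFn
    split_ifs <;> first | nlinarith | (exfalso; linarith)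
  have hωpsi : ∀ x y, x ≤ y → y < L*ρ →
      omegaFn m L ρ y - omegaFn m L ρ x ≤ psiFn K a L ρ h x - psiFn K a L ρ h y := by
    intro x y hxy hy
    have base : ∀ x y, x ≤ y → y ≤ -(L*ρ) →
        m/ρ*(y-x) ≤ psiFn K a L ρ h x - psiFn K a L ρ h y := by
      intro x y hxy hy
      refine le_trans ?_ (hpsi x y hxy (by linarith))
      have e : Real.exp (a*L) ≤ Real.exp (-(a/ρ)*y) := by
        apply Real.exp_le_exp.2
        have h1 : -(a/ρ)*y = a/ρ*(-y) := by ring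
        have h2 : a*L = a/ρ*(L*ρ) := by field_simp
        rw [h1, h2]
        have : L*ρ ≤ -y := by linarith
        gcongr
      have : 0 ≤ y - x := by linarith
      calc m/ρ*(y-x) = (y-x)/ρ * m := by ring
        _ ≤ _ := by
          gcongr
          linarith
    by_cases hx : x ≤ -(L*ρ)
    · by_cases hy' : y ≤ -(L*ρ)
      · have := base x y hxy hy'
        simp only [omegaFn, if_pos hx, if_pos hy']
        linarith
      · have h1 := base x (-(L*ρ)) hx le_rfl
        have h2 := hψ (-(L*ρ)) y (by linarith) hy
        simp only [omegaFn, if_pos hx, if_neg hy', if_pos hy]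
        linarith
    · have h2 := hψ x y hxy hy
      have hy' : ¬ y ≤ -(L*ρ) := by linarith
      simp only [omegaFn, if_neg hx, if_neg hy', if_pos hy, if_pos (hxy.trans_lt hy)]
      linarith
  have hh : ∀ t < L*ρ, |h t| ≤ 2 * Real.exp (m*(t/ρ+L)) := by
    intro t ht
    refine (hX.2.2.2 t).trans ?_
    have e : m*(t/ρ+L) = m/ρ*(t+L*ρ) := by field_simp
    rw [e]
    refine mul_le_mul_of_nonneg_left (Real.exp_le_exp.2 ?_) (by norm_num)
    unfold omegaFn
    split_ifs with h1
    · exact le_rfl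
    · have : 0 ≤ t + L*ρ := by linarith
      positivity
  -- one step
  have step : ∀ ε : ℝ, 0 ≤ ε →
      (∀ x < L*ρ, |h x| ≤ 2 * (Real.exp (-psiFn K a L ρ h x) + ε * Real.exp (omegaFn m L ρ x))) →
      ∀ x < L*ρ, |Rtil K a L ρ h x| ≤
        1/4 * (Real.exp (-psiFn K a L ρ h x) + ε * Real.exp (omegaFn m L ρ x)) := by
    intro ε hε hb x hx
    have := aux_Rtil K γ a K0 δ hK m L ρ hρ ha hm1 (by linarith) h
      (fun x => Real.exp (-psiFn K a L ρ h x) + ε * Real.exp (omegaFn m L ρ x)) C1 hC1 hQ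
      (fun x y hxy hy => by
        have h1 := hψ x y hxy hy
        have h2 := hωmono x y hxy hy
        gcongr)
      (fun x y hxy hy => by
        have h1 := hωpsi x y hxy hy
        rw [mul_add, ← Real.exp_add, mul_left_comm, ← Real.exp_add]
        gcongr
        · linarith
        · linarith)
      hb hh x hx
    rw [← hC] at this
    have hw0 : 0 ≤ Real.exp (-psiFn K a L ρ h x) + ε * Real.exp (omegaFn m L ρ x) := by positivity
    nlinarith
  have iter : ∀ n : ℕ, ∀ x < L*ρ,
      |h x| ≤ 2 * (Real.exp (-psiFn K a L ρ h x) + (1/2:ℝ)^n * Real.exp (omegaFn m L ρ x)) := by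
    intro n
    induction n with
    | zero =>
      intro x hx
      have := hX.2.2.2 x
      have := Real.exp_pos (-psiFn K a L ρ h x)
      simp only [pow_zero, one_mul]
      linarith
    | succ n ih =>
      intro x hx
      have h1 := step _ (by positivity) ih x hx
      rw [hE x hx]
      refine (abs_add_le _ _).trans ?_
      have h2 := Real.exp_pos (-psiFn K a L ρ h x)
      have h3 : 0 < (1/2:ℝ)^n * Real.exp (omegaFn m L ρ x) := by positivity
      rw [abs_of_pos (mul_pos (by linarith [hk1.1]) h2), pow_succ]
      have := mul_lt_mul_of_pos_right hk1.2 h2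
      nlinarith
  have lim : ∀ x < L*ρ, |h x| ≤ 2 * (Real.exp (-psiFn K a L ρ h x) + 0 * Real.exp (omegaFn m L ρ x)) := by
    intro x hx
    have t : Tendsto (fun n : ℕ => 2 * (Real.exp (-psiFn K a L ρ h x) + (1/2:ℝ)^n * Real.exp (omegaFn m L ρ x)))
        atTop (nhds (2 * (Real.exp (-psiFn K a L ρ h x) + 0 * Real.exp (omegaFn m L ρ x)))) :=
      (((tendsto_pow_atTop_nhds_zero_of_lt_one (by norm_num) (by norm_num)).mul_const _).const_add _).const_mul _
    exact ge_of_tendsto' t fun n => iter n x hx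
  intro x hx
  have h1 := abs_le.1 (step 0 le_rfl lim x hx)
  have h2 := (abs_le.1 (lim x hx)).2
  have h3 := Real.exp_pos (-psiFn K a L ρ h x)
  have h4 := mul_lt_mul_of_pos_right hk1.1 h3
  rw [zero_mul, add_zero] at h1 h2
  refine ⟨?_, h2⟩
  rw [hE x hx]
  linarith [h1.1]
end

section
/- Let h ∈ X_{L,ρ} and assume 1/2 ≤ Q[h](y) ≤ 3/2 for all y < Lρ and (1/4)·e^{−ψ_ρ[h](x)} ≤ h(x) ≤ 2·e^{−ψ_ρ[h](x)} for all x < Lρ. Then (1/4)·e^{(2/a)·(e^{−aL} − e^{−(a/ρ)x})} ≤ h(x) ≤ 2·e^{(1/(2a))·(e^{−aL} − e^{−(a/ρ)x})} for all x < Lρ. -/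
open Set MeasureTheory Filter

/-- explicit decay bounds at -∞ (Remark 5.2 of the paper). -/
theorem explicit_decay_at_minus_infinity
    (K : ℝ → ℝ → ℝ) (γ a K0 δ m L0 ρ0 L ρ : ℝ)
    (hK : KernelHyp K γ a K0 δ) (hP : ParamHyp a m L0 ρ0)
    (hL : L0 ≤ L) (hρ : ρ ∈ Ioo (0:ℝ) ρ0)
    (h : ℝ → ℝ) (hh : memX a m L ρ h)
    (hQ : ∀ y : ℝ, y < L*ρ → Qfun K a ρ h y ∈ Icc (1/2:ℝ) (3/2))
    (hpsi : ∀ x : ℝ, x < L*ρ →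
      (1/4) * Real.exp (-psiFn K a L ρ h x) ≤ h x ∧
      h x ≤ 2 * Real.exp (-psiFn K a L ρ h x)) :
    ∀ x : ℝ, x < L*ρ →
      (1/4) * Real.exp ((2/a) * (Real.exp (-a*L) - Real.exp (-(a/ρ)*x))) ≤ h x ∧
      h x ≤ 2 * Real.exp ((1/(2*a)) * (Real.exp (-a*L) - Real.exp (-(a/ρ)*x))) := by
  obtain ⟨hγ, ha, hKc, -⟩ := hK
  have ha0 : 0 < a := by linarith
  have hρ0 : 0 < ρ := hρ.1
  have hm : Measurable h := measurable_of_continuousOn_compl_singleton (L*ρ) hh.1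
  have hKm : Continuous (fun t : ℝ => K (Real.exp t) 1) := by
    have := hKc.comp_continuous (f := fun t : ℝ => (Real.exp t, (1:ℝ))) (by fun_prop)
      (fun t => ⟨Real.exp_pos t, by simp⟩)
    exact this
  have hQm : StronglyMeasurable (Qfun K a ρ h) := by
    have hj : StronglyMeasurable (fun p : ℝ × ℝ =>
        Real.exp (a/ρ*(p.1-p.2)) * K (Real.exp ((p.1-p.2)/ρ)) 1 * h p.2) := by
      apply Measurable.stronglyMeasurable
      have h1 : Measurable (fun p : ℝ × ℝ => K (Real.exp ((p.1-p.2)/ρ)) 1) :=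
        hKm.measurable.comp (g := fun t : ℝ => K (Real.exp t) 1)
          (f := fun p : ℝ × ℝ => (p.1-p.2)/ρ) (by fun_prop)
      have h2 : Measurable (fun p : ℝ × ℝ => h p.2) := hm.comp measurable_snd
      have h3 : Measurable (fun p : ℝ × ℝ => Real.exp (a/ρ*(p.1-p.2))) := by fun_prop
      exact (h3.mul h1).mul h2
    exact hj.integral_prod_right'
  intro x hx
  set D : ℝ := Real.exp (-(a/ρ)*x) - Real.exp (-a*L) with hD
  have hec : Continuous (fun y : ℝ => Real.exp (-(a/ρ)*y)) := by fun_prop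
  have hint : IntegrableOn (fun y : ℝ => Real.exp (-(a/ρ)*y)) (Ioo x (L*ρ)) :=
    (hec.integrableOn_Icc (a := x) (b := L*ρ)).mono_set Ioo_subset_Icc_self
  have hval : ∫ y in Ioo x (L*ρ), Real.exp (-(a/ρ)*y) = ρ/a*D := by
    rw [← integral_Ioc_eq_integral_Ioo, ← intervalIntegral.integral_of_le hx.le,
      intervalIntegral.integral_eq_sub_of_hasDerivAt
        (f := fun y => -(ρ/a) * Real.exp (-(a/ρ)*y))]
    · have : -(a/ρ)*(L*ρ) = -a*L := by field_simp
      simp only [this, hD]; ring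
    · intro y _
      have h1 : HasDerivAt (fun y : ℝ => -(a/ρ)*y) (-(a/ρ)) y := by
        simpa using (hasDerivAt_id y).const_mul (-(a/ρ))
      have e : -(ρ/a) * (Real.exp (-(a/ρ)*y) * (-(a/ρ))) = Real.exp (-(a/ρ)*y) := by
        have e' : ρ/a*(a/ρ) = 1 := by field_simp
        linear_combination Real.exp (-(a/ρ)*y) * e'
      have h2 := h1.exp.const_mul (-(ρ/a))
      rw [e] at h2
      exact h2
    · exact hec.intervalIntegrable _ _
  have hQint : IntegrableOn (fun y : ℝ => Real.exp (-(a/ρ)*y) * Qfun K a ρ h y)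
      (Ioo x (L*ρ)) := by
    refine Integrable.mono' (hint.const_mul (3/2))
      (hec.stronglyMeasurable.mul hQm).aestronglyMeasurable ?_
    refine (ae_restrict_mem measurableSet_Ioo).mono fun y hy => ?_
    have hq := hQ y hy.2
    have he := Real.exp_pos (-(a/ρ)*y)
    rw [Real.norm_eq_abs, abs_of_nonneg (mul_nonneg he.le (by linarith [hq.1]))]
    nlinarith [hq.2]
  have hlo : (1/2) * (ρ/a*D) ≤ ∫ y in Ioo x (L*ρ), Real.exp (-(a/ρ)*y) * Qfun K a ρ h y := by
    rw [← hval, ← integral_const_mul]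
    refine setIntegral_mono_on (hint.const_mul _) hQint measurableSet_Ioo fun y hy => ?_
    nlinarith [(hQ y hy.2).1, Real.exp_pos (-(a/ρ)*y)]
  have hup : ∫ y in Ioo x (L*ρ), Real.exp (-(a/ρ)*y) * Qfun K a ρ h y ≤ (3/2) * (ρ/a*D) := by
    rw [← hval, ← integral_const_mul]
    refine setIntegral_mono_on hQint (hint.const_mul _) measurableSet_Ioo fun y hy => ?_
    nlinarith [(hQ y hy.2).2, Real.exp_pos (-(a/ρ)*y)]
  have hD0 : 0 ≤ D := by
    have : -a*L ≤ -(a/ρ)*x := by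
      have e : -a*L = -(a/ρ)*(L*ρ) := by field_simp
      rw [e]
      have : 0 < a/ρ := by positivity
      nlinarith
    have := Real.exp_le_exp.mpr this
    linarith
  have hDa : 0 ≤ D/a := by positivity
  have hr : 0 ≤ 1/ρ := by positivity
  have h1 : (1/2) * (D/a) ≤ psiFn K a L ρ h x := by
    have := mul_le_mul_of_nonneg_left hlo hr
    have e : 1/ρ * ((1/2) * (ρ/a*D)) = (1/2) * (D/a) := by field_simp
    rw [e] at this
    exact this
  have h2 : psiFn K a L ρ h x ≤ (3/2) * (D/a) := by
    have := mul_le_mul_of_nonneg_left hup hr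
    have e : 1/ρ * ((3/2) * (ρ/a*D)) = (3/2) * (D/a) := by field_simp
    rw [e] at this
    exact this
  have e1 : (2/a) * (Real.exp (-a*L) - Real.exp (-(a/ρ)*x)) = -(2*(D/a)) := by
    rw [hD]; ring
  have e2 : (1/(2*a)) * (Real.exp (-a*L) - Real.exp (-(a/ρ)*x)) = -((1/2)*(D/a)) := by
    rw [hD]; field_simp; ring
  obtain ⟨p1, p2⟩ := hpsi x hx
  rw [e1, e2]
  have q1 := Real.exp_le_exp.mpr (show -(2*(D/a)) ≤ -psiFn K a L ρ h x by linarith)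
  have q2 := Real.exp_le_exp.mpr (show -psiFn K a L ρ h x ≤ -((1/2)*(D/a)) by linarith)
  constructor <;> linarith
end

section
/- For every L ≥ L0 there exists a constant C̄(L) > 0, depending only on the kernel (i.e. on K0, a, δ), on m, and on L, but not on ρ or σ, with the following property. Let ρ ∈ (0,ρ0), let h ∈ X_{L,ρ} satisfy 1/2 ≤ Q[h](y) ≤ 3/2 for all y < Lρ, and suppose that for some σ ∈ (0,1) one has |h(x)| ≤ 2·e^{−ψ_ρ[h](x)} + σ·e^{ω(x)} for all x < Lρ. Then |R̃[h](x)| ≤ C̄(L)·ρ·(e^{−ψ_ρ[h](x)} + σ²·e^{ω(x)}) for all x < Lρ. -/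
open Set MeasureTheory Filter

lemma aux_two {S T1 T2 : Set ℝ} {f g1 g2 : ℝ → ℝ} {A B : ℝ} (hS : MeasurableSet S)
    (h1 : S ⊆ T1) (h2 : S ⊆ T2) (hA : 0 ≤ A) (hB : 0 ≤ B)
    (hg1 : IntegrableOn g1 T1) (hg2 : IntegrableOn g2 T2)
    (p1 : ∀ x, 0 ≤ g1 x) (p2 : ∀ x, 0 ≤ g2 x)
    (hf : ∀ y ∈ S, |f y| ≤ A * g1 y + B * g2 y) :
    |∫ y in S, f y| ≤ A * (∫ y in T1, g1 y) + B * (∫ y in T2, g2 y) := by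
  have i1 : IntegrableOn (fun y => A * g1 y) S := (hg1.mono_set h1).const_mul A
  have i2 : IntegrableOn (fun y => B * g2 y) S := (hg2.mono_set h2).const_mul B
  have hle : |∫ y in S, f y| ≤ ∫ y in S, (A * g1 y + B * g2 y) := by
    have := norm_integral_le_of_norm_le (f := f) (i1.add i2)
      ((ae_restrict_iff' hS).2 (Eventually.of_forall hf))
    simpa using this
  rw [integral_add i1 i2, integral_const_mul, integral_const_mul] at hle
  refine hle.trans (add_le_add ?_ ?_)
  · exact mul_le_mul_of_nonneg_left (setIntegral_mono_set hg1
      (Eventually.of_forall p1) (LE.le.eventuallyLE h1)) hA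
  · exact mul_le_mul_of_nonneg_left (setIntegral_mono_set hg2
      (Eventually.of_forall p2) (LE.le.eventuallyLE h2)) hB

lemma aux_exp {S : Set ℝ} {f : ℝ → ℝ} {A B p q c : ℝ} (hS : MeasurableSet S)
    (h1 : S ⊆ Iic c) (hA : 0 ≤ A) (hB : 0 ≤ B) (hp : 0 < p) (hq : 0 < q)
    (hf : ∀ y ∈ S, |f y| ≤ A * Real.exp (p * y) + B * Real.exp (q * y)) :
    |∫ y in S, f y| ≤ A * (Real.exp (p * c) / p) + B * (Real.exp (q * c) / q) := by
  have := aux_two (f := f) hS h1 h1 hA hB (integrableOn_exp_mul_Iic hp c)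
    (integrableOn_exp_mul_Iic hq c) (fun x => (Real.exp_pos _).le) (fun x => (Real.exp_pos _).le) hf
  rwa [integral_exp_mul_Iic hp, integral_exp_mul_Iic hq] at this

lemma kernel_bd {K : ℝ → ℝ → ℝ} {γ a K0 δ : ℝ} (hK : KernelHyp K γ a K0 δ) {u : ℝ} (hu : 0 < u) :
    K u 1 ≤ (1 + K0) * (u ^ (-a) + u) := by
  obtain ⟨hγ, ha, hc, hnn, hsym, hhom, hK0, hδ, hb⟩ := hK
  have key : ∀ v : ℝ, 0 < v → v ≤ 1 → K v 1 ≤ (1 + K0) * v ^ (-a) := by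
    intro v hv hv1
    have h1 := hb v ⟨hv, by linarith⟩
    have h2 : v ^ δ ≤ 1 := Real.rpow_le_one hv.le hv1 hδ.1.le
    have h3 := (abs_le.1 h1).2
    have h4 : v ^ a * K v 1 ≤ 1 + K0 := by nlinarith
    have h5 : 0 < v ^ a := Real.rpow_pos_of_pos hv a
    rw [Real.rpow_neg hv.le, ← div_eq_mul_inv, le_div_iff₀ h5]
    linarith
  have hup : 0 < u ^ (-a) := Real.rpow_pos_of_pos hu _
  rcases le_total u 1 with h | h
  · have := key u hu h
    nlinarith
  · have hi : 0 < u⁻¹ := inv_pos.2 hu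
    have h1 := hhom 1 u⁻¹ u one_pos hi hu
    rw [mul_one, mul_inv_cancel₀ hu.ne', hsym 1 u⁻¹ one_pos hi] at h1
    have h2 := key u⁻¹ hi (inv_le_one_of_one_le₀ h)
    have h3 : u ^ γ * (u⁻¹) ^ (-a) = u := by
      rw [Real.inv_rpow hu.le, ← Real.rpow_neg hu.le, neg_neg, ← Real.rpow_add hu, ha]
      simp
    have h4 : 0 < u ^ γ := Real.rpow_pos_of_pos hu _
    calc K u 1 = u ^ γ * K u⁻¹ 1 := h1
      _ ≤ u ^ γ * ((1 + K0) * (u⁻¹) ^ (-a)) := by gcongr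
      _ = (1 + K0) * (u ^ γ * (u⁻¹) ^ (-a)) := by ring
      _ = (1 + K0) * u := by rw [h3]
      _ ≤ _ := by nlinarith

lemma R_bd {K : ℝ → ℝ → ℝ} {γ a K0 δ : ℝ} (hK : KernelHyp K γ a K0 δ) {m L ρ B x : ℝ}
    {h : ℝ → ℝ} (ha : 0 < a) (hm : a + 1 < m) (hρ : 0 < ρ) (hB : 0 ≤ B) (hx : x < L * ρ)
    (hh : ∀ s t, s < x → t < x → |h s * h t| ≤ B * Real.exp (m / ρ * (s + t))) :
    |Rfun K a L ρ h x| ≤ ρ * ((1 + K0) * (1 / (m * (m - a)) + 1 / ((m + 1) * (m - 1 - a)))) * B *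
      Real.exp ((2 * m - a) / ρ * x) := by
  have hK0 : 0 < K0 := hK.2.2.2.2.2.2.1
  have e1 : 0 < m := by linarith
  have e2 : 0 < m - a := by linarith
  have e3 : 0 < m - 1 - a := by linarith
  have e4 : 0 < m + 1 := by linarith
  have hpt : ∀ y z, y < x → z < x →
      |Real.exp (-(a/ρ)*z) * K (Real.exp ((y-z)/ρ)) 1 * h y * h z| ≤
      ((1 + K0) * B * Real.exp ((m - a) / ρ * y)) * Real.exp (m / ρ * z) +
      ((1 + K0) * B * Real.exp ((m + 1) / ρ * y)) * Real.exp ((m - 1 - a) / ρ * z) := by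
    intro y z hy hz
    have hu := Real.exp_pos ((y-z)/ρ)
    have hk := kernel_bd hK hu
    have hk0 : 0 ≤ K (Real.exp ((y-z)/ρ)) 1 := hK.2.2.2.1 _ _ hu one_pos
    rw [← Real.exp_mul] at hk
    rw [mul_assoc _ (h y), abs_mul, abs_of_nonneg (by positivity)]
    calc _ ≤ (Real.exp (-(a/ρ)*z) * ((1 + K0) * (Real.exp ((y - z) / ρ * -a) +
            Real.exp ((y - z) / ρ)))) * (B * Real.exp (m / ρ * (y + z))) := by
          gcongr
          exact hh y z hy hz
      _ = (1 + K0) * B * (Real.exp (-(a/ρ)*z) * Real.exp ((y - z) / ρ * -a) *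
            Real.exp (m / ρ * (y + z))) + (1 + K0) * B * (Real.exp (-(a/ρ)*z) *
            Real.exp ((y - z) / ρ) * Real.exp (m / ρ * (y + z))) := by ring
      _ = (1 + K0) * B * (Real.exp ((m - a) / ρ * y) * Real.exp (m / ρ * z)) +
          (1 + K0) * B * (Real.exp ((m + 1) / ρ * y) * Real.exp ((m - 1 - a) / ρ * z)) := by
          simp only [← Real.exp_add]
          congr 2
          · congr 1
            field_simp
            ring
          · congr 1
            field_simp
            ring
      _ = _ := by ring
  have hin : ∀ y ∈ Iio x, |∫ z in Iio (x + ρ * Real.log (1 - Real.exp ((y-x)/ρ))),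
      Real.exp (-(a/ρ)*z) * K (Real.exp ((y-z)/ρ)) 1 * h y * h z| ≤
      ((1 + K0) * B * (Real.exp (m / ρ * x) / (m / ρ))) * Real.exp ((m - a) / ρ * y) +
      ((1 + K0) * B * (Real.exp ((m - 1 - a) / ρ * x) / ((m - 1 - a) / ρ))) *
        Real.exp ((m + 1) / ρ * y) := by
    intro y hy
    have hy' : y < x := hy
    have hlog : Real.log (1 - Real.exp ((y-x)/ρ)) ≤ 0 := by
      apply Real.log_nonpos
      · have : Real.exp ((y-x)/ρ) ≤ 1 :=
          Real.exp_le_one_iff.2 (div_nonpos_of_nonpos_of_nonneg (by linarith) hρ.le)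
        linarith
      · have := Real.exp_pos ((y-x)/ρ)
        linarith
    have hle : x + ρ * Real.log (1 - Real.exp ((y-x)/ρ)) ≤ x := by nlinarith
    have := aux_exp (S := Iio (x + ρ * Real.log (1 - Real.exp ((y-x)/ρ)))) (c := x)
      measurableSet_Iio
      (fun z hz => (lt_of_lt_of_le hz hle).le)
      (by positivity) (by positivity) (by positivity) (by positivity)
      (fun z hz => hpt y z hy' (lt_of_lt_of_le hz hle))
    refine this.trans (le_of_eq (by ring))
  have hout := aux_exp (S := Iio x) (c := x) measurableSet_Iio
      (fun z hz => le_of_lt (mem_Iio.1 hz)) (by positivity) (by positivity) (by positivity) (by positivity) hin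
  rw [Rfun, if_pos hx, abs_mul, abs_neg, abs_of_pos (by positivity : 0 < 1 / ρ)]
  refine (mul_le_mul_of_nonneg_left hout (by positivity)).trans (le_of_eq ?_)
  have x1 : Real.exp ((2 * m - a) / ρ * x) = Real.exp (m / ρ * x) * Real.exp ((m - a) / ρ * x) := by
    rw [← Real.exp_add]; congr 1; ring
  have x2 : Real.exp (m / ρ * x) * Real.exp ((m - a) / ρ * x) =
      Real.exp ((m - 1 - a) / ρ * x) * Real.exp ((m + 1) / ρ * x) := by
    rw [← Real.exp_add, ← Real.exp_add]; congr 1; ring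
  have : 1 / ρ * ((1 + K0) * B * (Real.exp (m / ρ * x) / (m / ρ)) * (Real.exp ((m - a) / ρ * x) / ((m - a) / ρ)) +
      (1 + K0) * B * (Real.exp ((m - 1 - a) / ρ * x) / ((m - 1 - a) / ρ)) *
        (Real.exp ((m + 1) / ρ * x) / ((m + 1) / ρ))) =
      (1 + K0) * B * ρ * (1 / (m * (m - a))) * (Real.exp (m / ρ * x) * Real.exp ((m - a) / ρ * x)) +
      (1 + K0) * B * ρ * (1 / ((m + 1) * (m - 1 - a))) *
        (Real.exp ((m - 1 - a) / ρ * x) * Real.exp ((m + 1) / ρ * x)) := by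
    field_simp
  rw [this, ← x2, x1]
  ring

lemma Q_meas {K : ℝ → ℝ → ℝ} {γ a K0 δ : ℝ} (hK : KernelHyp K γ a K0 δ) {m L ρ : ℝ}
    {h : ℝ → ℝ} (hX : memX a m L ρ h) : StronglyMeasurable (Qfun K a ρ h) := by
  have hm : Measurable h := measurable_of_continuousOn_compl_singleton (L * ρ) hX.1
  have hc : Continuous (fun p : ℝ × ℝ => K (Real.exp ((p.1 - p.2)/ρ)) 1) := by
    have := hK.2.2.1.comp_continuous
      (f := fun p : ℝ × ℝ => ((Real.exp ((p.1 - p.2)/ρ), 1) : ℝ × ℝ)) (by fun_prop)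
      (fun p => ⟨Real.exp_pos _, mem_Ioi.2 one_pos⟩)
    exact this
  apply StronglyMeasurable.integral_prod_right
    (f := fun y z => Real.exp (a/ρ*(y-z)) * K (Real.exp ((y-z)/ρ)) 1 * h z)
  apply Measurable.stronglyMeasurable
  apply Measurable.mul
  · apply Measurable.mul
    · exact (by fun_prop : Continuous (fun p : ℝ × ℝ => Real.exp (a/ρ*(p.1-p.2)))).measurable
    · exact hc.measurable
  · exact hm.comp measurable_snd

lemma psi_bd {K : ℝ → ℝ → ℝ} {a m L ρ : ℝ} {h : ℝ → ℝ} (ha : 0 < a) (hm : 0 < m) (hρ : 0 < ρ)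
    (hL : 0 < L) (hLm : 4 * m ≤ Real.exp (a * L))
    (hQm : StronglyMeasurable (Qfun K a ρ h))
    (hQ : ∀ y : ℝ, y < L*ρ → Qfun K a ρ h y ∈ Icc (1/2:ℝ) (3/2))
    {x y : ℝ} (hxy : x < y) (hy : y ≤ L * ρ) :
    2 * m / ρ * (y - x) - 4 * m * L ≤ psiFn K a L ρ h x - psiFn K a L ρ h y := by
  set q : ℝ → ℝ := fun y => Real.exp (-(a/ρ)*y) * Qfun K a ρ h y with hq
  have qm : Measurable q := by
    apply Measurable.mul
    · fun_prop
    · exact hQm.measurable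
  have q0 : ∀ u, u < L * ρ → 0 ≤ q u := fun u hu => by
    have := (hQ u hu).1
    have := Real.exp_pos (-(a/ρ)*u)
    exact mul_nonneg this.le (by linarith)
  have qi : IntegrableOn q (Ioo x (L * ρ)) := by
    apply Measure.integrableOn_of_bounded (M := Real.exp (-(a/ρ)*x) * (3/2))
    · simp
    · exact qm.aestronglyMeasurable
    · refine (ae_restrict_iff' measurableSet_Ioo).2 (Eventually.of_forall fun u hu => ?_)
      rw [Real.norm_of_nonneg (q0 u hu.2)]
      have h1 := hQ u hu.2
      have h2 : Real.exp (-(a/ρ)*u) ≤ Real.exp (-(a/ρ)*x) := by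
        apply Real.exp_le_exp.2
        have : 0 < a / ρ := by positivity
        nlinarith [hu.1]
      exact mul_le_mul h2 h1.2 (by linarith [h1.1]) (Real.exp_pos _).le
  have hsplit : ∫ u in Ioo x (L*ρ), q u = (∫ u in Ioc x y, q u) + ∫ u in Ioo y (L*ρ), q u := by
    rcases hy.lt_or_eq with hy' | hy'
    · rw [← setIntegral_union _ measurableSet_Ioo]
      · rw [Ioc_union_Ioo_eq_Ioo hxy.le hy']
      · exact qi.mono_set (fun u hu => ⟨hu.1, lt_of_le_of_lt hu.2 hy'⟩)
      · exact qi.mono_set (fun u hu => ⟨hxy.trans hu.1, hu.2⟩)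
      · rw [Set.disjoint_left]
        intro u hu hu'
        exact absurd hu.2 (not_le.2 hu'.1)
    · rw [hy', Ioo_self, integral_Ioc_eq_integral_Ioo]; simp
  have hdiff : psiFn K a L ρ h x - psiFn K a L ρ h y = 1 / ρ * ∫ u in Ioo x y, q u := by
    rw [← integral_Ioc_eq_integral_Ioo]
    show 1 / ρ * (∫ u in Ioo x (L*ρ), q u) - 1 / ρ * (∫ u in Ioo y (L*ρ), q u) = _
    rw [hsplit]; ring
  rw [hdiff]
  have qi' : IntegrableOn q (Ioo x y) := qi.mono_set (fun u hu => ⟨hu.1, lt_of_lt_of_le hu.2 hy⟩)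
  have hnn : 0 ≤ ∫ u in Ioo x y, q u :=
    setIntegral_nonneg measurableSet_Ioo (fun u hu => q0 u (lt_of_lt_of_le hu.2 hy))
  set w := min y (-(L * ρ)) with hw
  have hLρ : 0 < L * ρ := by positivity
  have hwy : y - 2 * (L * ρ) ≤ w := le_min (by linarith) (by linarith)
  have goal' : 2 * m * (y - x) - 4 * m * (L * ρ) ≤ ∫ u in Ioo x y, q u := by
    rcases le_or_gt w x with hwx | hwx
    · nlinarith
    · have s1 : ∫ u in Ioo x w, q u ≤ ∫ u in Ioo x y, q u := by
        apply setIntegral_mono_set qi'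
        · exact (ae_restrict_iff' measurableSet_Ioo).2
            (Eventually.of_forall fun u hu => q0 u (lt_of_lt_of_le hu.2 hy))
        · exact LE.le.eventuallyLE
            (fun u hu => ⟨hu.1, lt_of_lt_of_le hu.2 (min_le_left _ _)⟩)
      have s2 : ∫ u in Ioo x w, (2 * m) ≤ ∫ u in Ioo x w, q u := by
        apply setIntegral_mono_on
        · exact integrableOn_const (by simp)
        · exact qi'.mono_set (fun u hu => ⟨hu.1, lt_of_lt_of_le hu.2 (min_le_left _ _)⟩)
        · exact measurableSet_Ioo
        · intro u hu
          have hu2 : u < -(L * ρ) := lt_of_lt_of_le hu.2 (min_le_right _ _)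
          have h1 := (hQ u (by linarith)).1
          have h2 : Real.exp (a * L) ≤ Real.exp (-(a/ρ)*u) := by
            apply Real.exp_le_exp.2
            have e : a * L = (a / ρ) * (L * ρ) := by field_simp
            have : 0 < a / ρ := by positivity
            rw [e]
            nlinarith
          show 2 * m ≤ Real.exp (-(a/ρ)*u) * Qfun K a ρ h u
          nlinarith
      have s3 : ∫ u in Ioo x w, (2 * m) = (w - x) * (2 * m) := by
        simp [hwx.le]
      nlinarith
  calc 2 * m / ρ * (y - x) - 4 * m * L = 1 / ρ * (2 * m * (y - x) - 4 * m * (L * ρ)) := by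
        field_simp
    _ ≤ _ := by gcongr

lemma omega_bds {m L ρ x : ℝ} (hm : 0 < m) (hρ : 0 < ρ) (hL : 0 < L) (hx : x < L * ρ) :
    omegaFn m L ρ x ≤ m / ρ * x + m * L ∧ m / ρ * x - m * L ≤ omegaFn m L ρ x := by
  have hmρ : 0 < m / ρ := by positivity
  have e : m * L = m / ρ * (L * ρ) := by field_simp
  rw [e]
  have : 0 < L * ρ := by positivity
  unfold omegaFn
  split_ifs with h1
  · constructor <;> nlinarith
  · push Not at h1
    constructor <;> nlinarith

lemma prod_bd {K : ℝ → ℝ → ℝ} {a m L ρ σ : ℝ} {h : ℝ → ℝ} (hm : 0 < m) (hρ : 0 < ρ)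
    (hL : 0 < L) (hσ : 0 < σ)
    (hψ : ∀ x y, x < y → y ≤ L * ρ →
      2 * m / ρ * (y - x) - 4 * m * L ≤ psiFn K a L ρ h x - psiFn K a L ρ h y)
    (hh : ∀ x : ℝ, x < L*ρ →
        |h x| ≤ 2 * Real.exp (-psiFn K a L ρ h x) + σ * Real.exp (omegaFn m L ρ x))
    {x : ℝ} (hx : x < L * ρ) (s t : ℝ) (hs : s < x) (ht : t < x) :
    |h s * h t| ≤ (8 * Real.exp (11 * (m * L)) * (Real.exp (-psiFn K a L ρ h x) *
      Real.exp (-(m / ρ * x)) + σ ^ 2)) * Real.exp (m / ρ * (s + t)) := by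
  have hmρ : 0 < m / ρ := by positivity
  have hmL : 0 < m * L := by positivity
  have e : m * L = m / ρ * (L * ρ) := by field_simp
  set P := Real.exp (4 * (m * L) - psiFn K a L ρ h x - m / ρ * x) with hP
  have one : ∀ u, u < x → |h u| ≤ (2 * P + σ * Real.exp (m * L)) * Real.exp (m / ρ * u) := by
    intro u hu
    have h1 := hψ u x hu hx.le
    have h2 : Real.exp (-psiFn K a L ρ h u) ≤ P * Real.exp (m / ρ * u) := by
      rw [hP, ← Real.exp_add]
      apply Real.exp_le_exp.2
      have : 2 * m / ρ * (x - u) = 2 * (m / ρ * (x - u)) := by ring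
      have : 0 < m / ρ * (x - u) := mul_pos hmρ (by linarith)
      nlinarith
    have h3 : Real.exp (omegaFn m L ρ u) ≤ Real.exp (m * L) * Real.exp (m / ρ * u) := by
      rw [← Real.exp_add]
      apply Real.exp_le_exp.2
      linarith [(omega_bds hm hρ hL (hu.trans hx)).1]
    calc _ ≤ _ := hh u (hu.trans hx)
      _ ≤ 2 * (P * Real.exp (m / ρ * u)) + σ * (Real.exp (m * L) * Real.exp (m / ρ * u)) := by
        gcongr
      _ = _ := by ring
  have hP7 : P ≤ Real.exp (7 * (m * L)) := by
    apply Real.exp_le_exp.2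
    have h1 := hψ x (L * ρ) hx le_rfl
    have h0 : psiFn K a L ρ h (L * ρ) = 0 := by simp [psiFn]
    rw [h0] at h1
    have : 2 * m / ρ * (L * ρ - x) = 2 * (m * L) - 2 * (m / ρ * x) := by rw [e]; ring
    have : m / ρ * x ≤ m * L := by rw [e]; exact mul_le_mul_of_nonneg_left hx.le hmρ.le
    nlinarith
  have hPpos : 0 < P := Real.exp_pos _
  have hP2 : P ^ 2 ≤ Real.exp (11 * (m * L)) * (Real.exp (-psiFn K a L ρ h x) *
      Real.exp (-(m / ρ * x))) := by
    calc P ^ 2 ≤ Real.exp (7 * (m * L)) * P := by nlinarith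
      _ = _ := by
        rw [hP, ← Real.exp_add, ← Real.exp_add, ← Real.exp_add]
        congr 1
        ring
  have hΛ : Real.exp (m * L) ^ 2 ≤ Real.exp (11 * (m * L)) := by
    rw [← Real.exp_nat_mul]
    apply Real.exp_le_exp.2
    push_cast
    linarith
  have hst : Real.exp (m / ρ * (s + t)) = Real.exp (m / ρ * s) * Real.exp (m / ρ * t) := by
    rw [← Real.exp_add]; congr 1; ring
  have hΛ0 := Real.exp_pos (m * L)
  have hΛ1 := Real.exp_pos (11 * (m * L))
  rw [abs_mul, hst]
  calc _ ≤ ((2 * P + σ * Real.exp (m * L)) * Real.exp (m / ρ * s)) *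
        ((2 * P + σ * Real.exp (m * L)) * Real.exp (m / ρ * t)) := by
        gcongr
        · exact one s hs
        · exact one t ht
    _ = (2 * P + σ * Real.exp (m * L)) ^ 2 * (Real.exp (m / ρ * s) * Real.exp (m / ρ * t)) := by
        ring
    _ ≤ _ := by
        gcongr
        have : σ ^ 2 * Real.exp (m * L) ^ 2 ≤ σ ^ 2 * Real.exp (11 * (m * L)) := by gcongr
        nlinarith [sq_nonneg (2 * P - σ * Real.exp (m * L)),
          mul_nonneg (sq_nonneg σ) hΛ1.le]

set_option maxHeartbeats 4000000

/-- iteration estimate for R̃[h] (Lemma 5.3 of the paper). -/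
theorem Rtil_iteration_estimate
    (K : ℝ → ℝ → ℝ) (γ a K0 δ m L0 ρ0 : ℝ)
    (hK : KernelHyp K γ a K0 δ) (hP : ParamHyp a m L0 ρ0) :
    ∀ L : ℝ, L0 ≤ L → ∃ Cbar : ℝ, 0 < Cbar ∧
      ∀ ρ ∈ Ioo (0:ℝ) ρ0, ∀ h : ℝ → ℝ, memX a m L ρ h →
      (∀ y : ℝ, y < L*ρ → Qfun K a ρ h y ∈ Icc (1/2:ℝ) (3/2)) →
      ∀ σ ∈ Ioo (0:ℝ) 1,
      (∀ x : ℝ, x < L*ρ →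
        |h x| ≤ 2 * Real.exp (-psiFn K a L ρ h x) + σ * Real.exp (omegaFn m L ρ x)) →
      ∀ x : ℝ, x < L*ρ →
        |Rtil K a L ρ h x|
          ≤ Cbar * ρ * (Real.exp (-psiFn K a L ρ h x) + σ^2 * Real.exp (omegaFn m L ρ x)) := by
  obtain ⟨hm0, hL0, hρ0⟩ := hP
  have hδ := hK.2.2.2.2.2.2.2.1
  have hK0 : 0 < K0 := hK.2.2.2.2.2.2.1
  have ha : 0 < a := hδ.1.trans (lt_of_lt_of_le hδ.2 (min_le_right _ _))
  have hm1 : a + 1 < m := lt_of_le_of_lt (le_max_left _ _) hm0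
  have hm3 : 3 * a < m := lt_of_le_of_lt (le_max_right _ _) hm0
  have hm : 0 < m := by linarith
  intro L hL'
  have hlogL : Real.log (4 * m) < a * L := by
    have : (1/a) * Real.log (4*m) < L := hL0.trans_le hL'
    rw [one_div, inv_mul_lt_iff₀ ha] at this
    exact this
  have hLm : 4 * m ≤ Real.exp (a * L) := ((Real.log_lt_iff_lt_exp (by positivity)).1 hlogL).le
  have hL : 0 < L := by
    have : 0 < Real.log (4 * m) := Real.log_pos (by linarith)
    exact pos_of_mul_pos_right (this.trans hlogL) ha.le
  have e2 : 0 < m - a := by linarith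
  have e3 : 0 < m - 1 - a := by linarith
  have e4 : 0 < m - 2 * a := by linarith
  have e5 : 0 < m + 1 := by linarith
  set C3 := ((1 + K0) * (1 / (m * (m - a)) + 1 / ((m + 1) * (m - 1 - a)))) *
    (8 * Real.exp (11 * (m * L))) with hC3
  have hC3p : 0 < C3 := by positivity
  set D := Real.exp ((m - 2 * a) * L) with hD
  have hDp : 0 < D := Real.exp_pos _
  set F := Real.exp ((m - a) * L) with hF
  have hFp : 0 < F := Real.exp_pos _
  set Λ := Real.exp (m * L) with hΛ
  have hΛp : 1 ≤ Λ := Real.one_le_exp (by positivity)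
  refine ⟨C3 * (F * Λ + 3 / 2 * (D / (m - 2 * a) + Λ ^ 5 * D / (2 * a))), by positivity, ?_⟩
  intro ρ hρ' h hX hQ σ hσ hh x hx
  have hρ : 0 < ρ := hρ'.1
  have hmρ : 0 < m / ρ := by positivity
  have hQm := Q_meas hK hX
  have hψ : ∀ x y, x < y → y ≤ L * ρ →
      2 * m / ρ * (y - x) - 4 * m * L ≤ psiFn K a L ρ h x - psiFn K a L ρ h y :=
    fun x y hxy hy => psi_bd ha hm hρ hL hLm hQm hQ hxy hy
  have hR : ∀ y, y < L * ρ → |Rfun K a L ρ h y| ≤ ρ * C3 *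
      (Real.exp (-psiFn K a L ρ h y) * Real.exp ((m - a) / ρ * y) +
        σ ^ 2 * Real.exp ((2 * m - a) / ρ * y)) := by
    intro y hy
    refine (R_bd hK ha hm1 hρ (by positivity) hy (prod_bd hm hρ hL hσ.1 hψ hh hy)).trans
      (le_of_eq ?_)
    have : Real.exp ((m - a) / ρ * y) = Real.exp (-(m / ρ * y)) * Real.exp ((2 * m - a) / ρ * y) := by
      rw [← Real.exp_add]; congr 1; ring
    rw [this, hC3]
    ring
  have hint : |∫ y in Ioo x (L*ρ),
      Real.exp (-(psiFn K a L ρ h x - psiFn K a L ρ h y)) * Real.exp (-(a/ρ)*y) *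
        Qfun K a ρ h y * Rfun K a L ρ h y| ≤
      (3 / 2 * (ρ * C3) * Real.exp (-psiFn K a L ρ h x)) *
        (∫ y in Iic (L * ρ), Real.exp ((m - 2 * a) / ρ * y)) +
      (3 / 2 * (ρ * C3) * (σ ^ 2 * (Λ ^ 4 * Real.exp (2 * m / ρ * x)))) *
        (∫ y in Ioi x, Real.exp (-(2 * a / ρ) * y)) := by
    apply aux_two measurableSet_Ioo (fun y hy => le_of_lt hy.2) (fun y hy => hy.1)
      (by positivity) (by positivity) (integrableOn_exp_mul_Iic (by positivity) _)
      (integrableOn_exp_mul_Ioi (neg_lt_zero.2 (by positivity)) _)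
      (fun x => (Real.exp_pos _).le) (fun x => (Real.exp_pos _).le)
    intro y hy
    have h1 := hR y hy.2
    have h2 := hQ y hy.2
    have h3 : Real.exp (-(psiFn K a L ρ h x - psiFn K a L ρ h y)) ≤
        Λ ^ 4 * Real.exp (2 * m / ρ * (x - y)) := by
      rw [hΛ, ← Real.exp_nat_mul, ← Real.exp_add]
      apply Real.exp_le_exp.2
      have := hψ x y hy.1 hy.2.le
      push_cast
      nlinarith
    have i1 : Real.exp (-(psiFn K a L ρ h x - psiFn K a L ρ h y)) * Real.exp (-(a/ρ)*y) *
        (Real.exp (-psiFn K a L ρ h y) * Real.exp ((m - a) / ρ * y)) =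
        Real.exp (-psiFn K a L ρ h x) * Real.exp ((m - 2 * a) / ρ * y) := by
      simp only [← Real.exp_add]; congr 1; ring
    have i2 : Real.exp (2 * m / ρ * (x - y)) * Real.exp (-(a/ρ)*y) *
        Real.exp ((2 * m - a) / ρ * y) =
        Real.exp (2 * m / ρ * x) * Real.exp (-(2 * a / ρ) * y) := by
      simp only [← Real.exp_add]; congr 1; ring
    have h2' : 0 ≤ Qfun K a ρ h y := by linarith [h2.1]
    rw [abs_mul, abs_of_nonneg (by positivity)]
    calc _ ≤ Real.exp (-(psiFn K a L ρ h x - psiFn K a L ρ h y)) * Real.exp (-(a/ρ)*y) *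
          (3 / 2) * (ρ * C3 * (Real.exp (-psiFn K a L ρ h y) * Real.exp ((m - a) / ρ * y) +
          σ ^ 2 * Real.exp ((2 * m - a) / ρ * y))) := by
          gcongr
          exact h2.2
      _ = 3 / 2 * (ρ * C3) * (Real.exp (-(psiFn K a L ρ h x - psiFn K a L ρ h y)) *
          Real.exp (-(a/ρ)*y) * (Real.exp (-psiFn K a L ρ h y) * Real.exp ((m - a) / ρ * y))) +
          3 / 2 * (ρ * C3) * (σ ^ 2 * (Real.exp (-(psiFn K a L ρ h x - psiFn K a L ρ h y)) *
          (Real.exp (-(a/ρ)*y) * Real.exp ((2 * m - a) / ρ * y)))) := by ring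
      _ ≤ 3 / 2 * (ρ * C3) * (Real.exp (-psiFn K a L ρ h x) * Real.exp ((m - 2 * a) / ρ * y)) +
          3 / 2 * (ρ * C3) * (σ ^ 2 * (Λ ^ 4 * Real.exp (2 * m / ρ * (x - y)) *
          (Real.exp (-(a/ρ)*y) * Real.exp ((2 * m - a) / ρ * y)))) := by
          rw [i1]
          gcongr
      _ = 3 / 2 * (ρ * C3) * (Real.exp (-psiFn K a L ρ h x) * Real.exp ((m - 2 * a) / ρ * y)) +
          3 / 2 * (ρ * C3) * (σ ^ 2 * (Λ ^ 4 * (Real.exp (2 * m / ρ * (x - y)) *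
          Real.exp (-(a/ρ)*y) * Real.exp ((2 * m - a) / ρ * y)))) := by ring
      _ = _ := by rw [i2]; ring
  rw [integral_exp_mul_Iic (by positivity),
    integral_exp_mul_Ioi (neg_lt_zero.2 (by positivity))] at hint
  have hE := Real.exp_pos (-psiFn K a L ρ h x)
  set E := Real.exp (-psiFn K a L ρ h x) with hEdef
  have hV := Real.exp_pos (m / ρ * x)
  set V := Real.exp (m / ρ * x) with hVdef
  have hW := Real.exp_pos (omegaFn m L ρ x)
  set W := Real.exp (omegaFn m L ρ x) with hWdef
  have hVW : V ≤ Λ * W := by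
    rw [hVdef, hΛ, hWdef, ← Real.exp_add]
    apply Real.exp_le_exp.2
    linarith [(omega_bds hm hρ hL hx).2]
  have lin : ∀ c : ℝ, 0 < c → c / ρ * x ≤ c * L := by
    intro c hc
    have : c * L = c / ρ * (L * ρ) := by field_simp
    rw [this]
    exact mul_le_mul_of_nonneg_left hx.le (by positivity)
  have b1 : Real.exp ((m - a) / ρ * x) ≤ F := Real.exp_le_exp.2 (lin _ e2)
  have b2 : Real.exp ((2 * m - a) / ρ * x) ≤ F * (Λ * W) := by
    have : Real.exp ((2 * m - a) / ρ * x) = Real.exp ((m - a) / ρ * x) * V := by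
      rw [hVdef, ← Real.exp_add]; congr 1; ring
    rw [this]
    gcongr
  have b3 : Real.exp ((m - 2 * a) / ρ * (L * ρ)) = D := by
    rw [hD]; congr 1; field_simp
  have b4 : Real.exp (2 * m / ρ * x) * Real.exp (-(2 * a / ρ) * x) ≤ D * (Λ * W) := by
    have : Real.exp (2 * m / ρ * x) * Real.exp (-(2 * a / ρ) * x) =
        Real.exp ((m - 2 * a) / ρ * x) * V := by
      rw [hVdef, ← Real.exp_add, ← Real.exp_add]; congr 1; ring
    rw [this]
    gcongr
    exact Real.exp_le_exp.2 (lin _ e4)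
  have hR1 : |Rfun K a L ρ h x| ≤ ρ * C3 * (F * Λ) * (E + σ ^ 2 * W) := by
    calc _ ≤ _ := hR x hx
      _ ≤ ρ * C3 * (E * F + σ ^ 2 * (F * (Λ * W))) := by gcongr
      _ ≤ ρ * C3 * (E * (F * Λ) + σ ^ 2 * (F * (Λ * W))) := by
        gcongr
        nlinarith
      _ = _ := by ring
  have hint2 : (1 / ρ) * |∫ y in Ioo x (L*ρ),
      Real.exp (-(psiFn K a L ρ h x - psiFn K a L ρ h y)) * Real.exp (-(a/ρ)*y) *
        Qfun K a ρ h y * Rfun K a L ρ h y| ≤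
      ρ * C3 * (3 / 2 * (D / (m - 2 * a) + Λ ^ 5 * D / (2 * a))) * (E + σ ^ 2 * W) := by
    rw [b3] at hint
    have hσ2 : 0 ≤ σ ^ 2 := sq_nonneg σ
    calc _ ≤ 1 / ρ * _ := mul_le_mul_of_nonneg_left hint (by positivity)
      _ = ρ * C3 * (3 / 2) * (D / (m - 2 * a) * E + σ ^ 2 * (Λ ^ 4 / (2 * a)) *
          (Real.exp (2 * m / ρ * x) * Real.exp (-(2 * a / ρ) * x))) := by
          field_simp
      _ ≤ ρ * C3 * (3 / 2) * (D / (m - 2 * a) * E + σ ^ 2 * (Λ ^ 4 / (2 * a)) *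
          (D * (Λ * W))) := by gcongr
      _ = ρ * C3 * (3 / 2) * (D / (m - 2 * a) * E + (Λ ^ 5 * D / (2 * a)) * (σ ^ 2 * W)) := by
          ring
      _ ≤ ρ * C3 * (3 / 2) * ((D / (m - 2 * a) + Λ ^ 5 * D / (2 * a)) * (E + σ ^ 2 * W)) := by
          gcongr
          have p1 : 0 < D / (m - 2 * a) := by positivity
          have p2 : 0 < Λ ^ 5 * D / (2 * a) := by positivity
          have p3 : 0 ≤ σ ^ 2 * W := by positivity
          nlinarith [mul_nonneg p1.le p3, mul_nonneg p2.le hE.le]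
      _ = _ := by ring
  rw [Rtil, if_pos hx]
  refine (abs_sub _ _).trans ?_
  rw [abs_mul, abs_of_pos (by positivity : 0 < 1 / ρ)]
  calc _ ≤ _ := add_le_add hR1 hint2
    _ = _ := by ring
end

section
/- For every L ≥ L0 there exist a constant A_L > 0 and ρ̄(L) ∈ (0,ρ0), depending only on the kernel (K0, a, δ), on m, and on L, but not on τ or ρ, with the following property. Let ρ ∈ (0, ρ̄(L)) and let h ∈ X_{L,ρ} be continuous on all of ℝ, solve equation (E), satisfy 1/2 ≤ Q[h](y) ≤ 3/2 for all y < Lρ, and satisfy |h(x)| ≤ 2·e^{λ(x)} for all x ∈ ℝ. Then for every τ ∈ (0,ρ) and every x ≥ Lρ one has |(h(x) − h(x−τ))/τ| ≤ (A_L/ρ)·e^{−(1/2)(x−Lρ)}. -/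
open Set MeasureTheory Filter

section Aux

structure IB {α : Type*} [MeasureSpace α] (f : α → ℝ) (C : ℝ) : Prop where
  int : Integrable f
  nn : ∀ x, 0 ≤ f x
  le : ∫ x, f x ≤ C

theorem IB.add {α : Type*} [MeasureSpace α] {f g : α → ℝ} {C D : ℝ} (hf : IB f C) (hg : IB g D) :
    IB (fun x => f x + g x) (C + D) :=
  ⟨hf.int.add hg.int, fun x => add_nonneg (hf.nn x) (hg.nn x), by
    rw [integral_add hf.int hg.int]; exact add_le_add hf.le hg.le⟩

theorem IB.cmul {α : Type*} [MeasureSpace α] {f : α → ℝ} {C c : ℝ} (hc : 0 ≤ c) (hf : IB f C) :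
    IB (fun x => c * f x) (c * C) :=
  ⟨hf.int.const_mul c, fun x => mul_nonneg hc (hf.nn x), by
    rw [integral_const_mul]; exact mul_le_mul_of_nonneg_left hf.le hc⟩

theorem IB.cnn {α : Type*} [MeasureSpace α] {f : α → ℝ} {C : ℝ} (hf : IB f C) : 0 ≤ C :=
  (integral_nonneg hf.nn).trans hf.le

theorem IB.weak {α : Type*} [MeasureSpace α] {f : α → ℝ} {C D : ℝ} (hf : IB f C) (h : C ≤ D) :
    IB f D := ⟨hf.int, hf.nn, hf.le.trans h⟩

theorem IB.prod {f g : ℝ → ℝ} {C D : ℝ} (hf : IB f C) (hg : IB g D) :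
    IB (fun p : ℝ × ℝ => f p.1 * g p.2) (C * D) :=
  ⟨hf.int.mul_prod hg.int, fun x => mul_nonneg (hf.nn _) (hg.nn _), by
    have : ∫ p : ℝ × ℝ, f p.1 * g p.2 = (∫ x, f x) * ∫ x, g x := integral_prod_mul f g
    rw [this]
    exact mul_le_mul hf.le hg.le (integral_nonneg hg.nn) hf.cnn⟩

theorem IB.mono {α : Type*} [MeasureSpace α] {f g : α → ℝ} {C : ℝ} (hg : IB g C)
    (hf : Measurable f) (h0 : ∀ x, 0 ≤ f x) (h : ∀ x, f x ≤ g x) : IB f C := by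
  have hi : Integrable f := hg.int.mono' hf.aestronglyMeasurable
    (Eventually.of_forall fun x => by rw [Real.norm_eq_abs, abs_of_nonneg (h0 x)]; exact h x)
  exact ⟨hi, h0, (integral_mono hi hg.int h).trans hg.le⟩

theorem IB.bound {α : Type*} [MeasureSpace α] {f g : α → ℝ} {C : ℝ} (hg : IB g C)
    (h : ∀ x, |f x| ≤ g x) : |∫ x, f x| ≤ C := by
  rw [← Real.norm_eq_abs]
  exact (norm_integral_le_of_norm_le hg.int (Eventually.of_forall h)).trans hg.le

theorem IB_abs {c : ℝ} (hc : 0 < c) : IB (fun v : ℝ => Real.exp (-c * |v|)) (2 / c) := by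
  refine ⟨?_, fun x => (Real.exp_pos _).le, ?_⟩
  · have h1 : IntegrableOn (fun v : ℝ => Real.exp (-c * |v|)) (Iic 0) := by
      refine (integrableOn_exp_mul_Iic hc 0).congr_fun (fun x hx => ?_) measurableSet_Iic
      simp only
      rw [abs_of_nonpos hx]; congr 1; ring
    have h2 : IntegrableOn (fun v : ℝ => Real.exp (-c * |v|)) (Ioi 0) := by
      refine (exp_neg_integrableOn_Ioi 0 hc).congr_fun (fun x hx => ?_) measurableSet_Ioi
      simp only
      rw [abs_of_pos hx]
    have := h1.union h2
    rwa [Iic_union_Ioi, integrableOn_univ] at this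
  · rw [integral_comp_abs (f := fun v => Real.exp (-c * v)), integral_exp_mul_Ioi (by linarith)]
    simp only [mul_zero, Real.exp_zero]
    apply le_of_eq; field_simp

noncomputable def Ph (q ρ v : ℝ) : ℝ := min (Real.exp (q*v)) (Real.exp (-(ρ/2)*v))

theorem Ph_pos (q ρ v : ℝ) : 0 < Ph q ρ v := lt_min (Real.exp_pos _) (Real.exp_pos _)

theorem Ph_cont (q ρ : ℝ) : Continuous (Ph q ρ) := by unfold Ph; fun_prop

theorem Ph_le2 (q ρ v : ℝ) : Ph q ρ v ≤ Real.exp (-(ρ/2)*v) := min_le_right _ _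

theorem Ph_le1 (q ρ v : ℝ) : Ph q ρ v ≤ Real.exp (q*v) := min_le_left _ _

theorem Ph_mono {q m ρ : ℝ} (hq : 0 ≤ q) (hqm : q ≤ m) (hρ : 0 ≤ ρ) (v : ℝ) :
    Ph m ρ v ≤ Ph q ρ v := by
  rcases le_total v 0 with hv | hv
  · refine le_min ((Ph_le1 _ _ _).trans (Real.exp_le_exp.2 ?_)) (Ph_le2 _ _ _)
    exact mul_le_mul_of_nonpos_right hqm hv
  · refine le_min ((Ph_le2 _ _ _).trans (Real.exp_le_exp.2 ?_)) (Ph_le2 _ _ _)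
    nlinarith [mul_nonneg hq hv, mul_nonneg hρ hv]

theorem Ph_of_nonneg {q ρ v : ℝ} (hq : 0 ≤ q) (hρ : 0 ≤ ρ) (hv : 0 ≤ v) :
    Ph q ρ v = Real.exp (-(ρ/2)*v) := by
  refine min_eq_right (Real.exp_le_exp.2 ?_)
  nlinarith [mul_nonneg hq hv, mul_nonneg hρ hv]

theorem Ph_of_nonpos {q ρ v : ℝ} (hq : 0 ≤ q) (hρ : 0 ≤ ρ) (hv : v ≤ 0) :
    Ph q ρ v = Real.exp (q*v) := by
  refine min_eq_left (Real.exp_le_exp.2 ?_)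
  nlinarith [mul_nonneg hq (neg_nonneg.2 hv), mul_nonneg hρ (neg_nonneg.2 hv)]

theorem Ph_shift {q ρ t : ℝ} (hq : 0 ≤ q) (hρ : 0 ≤ ρ) (hρ1 : ρ ≤ 1) (ht : 0 ≤ t) (ht1 : t ≤ 1)
    (v : ℝ) : Ph q ρ (v - t) ≤ Real.exp 1 * Ph q ρ v := by
  unfold Ph
  rw [mul_min_of_nonneg _ _ (Real.exp_pos 1).le, ← Real.exp_add, ← Real.exp_add]
  refine min_le_min (Real.exp_le_exp.2 ?_) (Real.exp_le_exp.2 ?_)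
  · nlinarith [mul_nonneg hq ht]
  · nlinarith [mul_nonneg hρ ht]

theorem Ph_IB {q ρ s c : ℝ} (hc : 0 < c) (h1 : c ≤ q - s) (h2 : c ≤ s + ρ/2) :
    IB (fun v => Real.exp (-s*v) * Ph q ρ v) (2/c) := by
  refine (IB_abs hc).mono ?_ ?_ ?_
  · have := Ph_cont q ρ
    exact Continuous.measurable (by fun_prop)
  · intro x; exact mul_nonneg (Real.exp_pos _).le (Ph_pos _ _ _).le
  · intro v
    rcases le_total v 0 with hv | hv
    · rw [abs_of_nonpos hv]
      refine (mul_le_mul_of_nonneg_left (Ph_le1 _ _ _) (Real.exp_pos _).le).trans ?_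
      rw [← Real.exp_add]
      refine Real.exp_le_exp.2 ?_
      nlinarith [mul_le_mul_of_nonpos_right h1 hv]
    · rw [abs_of_nonneg hv]
      refine (mul_le_mul_of_nonneg_left (Ph_le2 _ _ _) (Real.exp_pos _).le).trans ?_
      rw [← Real.exp_add]
      refine Real.exp_le_exp.2 ?_
      nlinarith [mul_le_mul_of_nonneg_right h2 hv]

/-- truncated exponential -/
noncomputable def e1 (b c v : ℝ) : ℝ := if b ≤ Real.exp v ∧ Real.exp v ≤ c then Real.exp v else 0

theorem e1_nonneg (b c v : ℝ) : 0 ≤ e1 b c v := by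
  unfold e1; split_ifs; exacts [(Real.exp_pos _).le, le_rfl]

theorem e1_IB {b c : ℝ} (hbc : b ≤ c) : IB (e1 b c) (c - b) := by
  have hm : Measurable (e1 b c) := by
    unfold e1
    refine Measurable.ite ?_ Real.measurable_exp measurable_const
    exact (measurableSet_le measurable_const Real.measurable_exp).inter
      (measurableSet_le Real.measurable_exp measurable_const)
  rcases le_or_gt c 0 with hc | hc
  · have : e1 b c = fun _ => 0 := by
      funext v
      unfold e1
      rw [if_neg]; intro h; linarith [Real.exp_pos v, h.2]
    rw [this]
    exact ⟨integrable_zero _ _ _, fun _ => le_rfl, by simp; exact hbc⟩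
  rcases le_or_gt b 0 with hb | hb
  · have h : IB ((Iic (Real.log c)).indicator Real.exp) c := by
      refine ⟨(integrable_indicator_iff measurableSet_Iic).2 (integrableOn_exp_Iic _),
        fun x => indicator_nonneg (fun _ _ => (Real.exp_pos _).le) _, ?_⟩
      rw [integral_indicator measurableSet_Iic, integral_exp_Iic, Real.exp_log hc]
    refine (h.weak (by linarith)).mono hm (e1_nonneg _ _) ?_
    intro v
    unfold e1
    split_ifs with h
    · rw [indicator_of_mem]
      rw [mem_Iic, Real.le_log_iff_exp_le hc]; exact h.2
    · exact indicator_nonneg (fun _ _ => (Real.exp_pos _).le) _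
  · have h : IB ((Ioc (Real.log b) (Real.log c)).indicator Real.exp) (c - b) := by
      refine ⟨(integrable_indicator_iff measurableSet_Ioc).2
        (Real.continuous_exp.integrableOn_Ioc),
        fun x => indicator_nonneg (fun _ _ => (Real.exp_pos _).le) _, ?_⟩
      rw [integral_indicator measurableSet_Ioc, ← intervalIntegral.integral_of_le
        (Real.log_le_log hb hbc), integral_exp, Real.exp_log hc, Real.exp_log hb]
    have h2 : e1 b c =ᵐ[volume] (Ioc (Real.log b) (Real.log c)).indicator Real.exp := by
      have : ∀ᵐ v : ℝ, v ≠ Real.log b := by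
        simp [ae_iff]
      filter_upwards [this] with v hv
      unfold e1
      split_ifs with h
      · rw [indicator_of_mem]
        refine ⟨lt_of_le_of_ne ?_ (Ne.symm hv), ?_⟩
        · rw [Real.log_le_iff_le_exp hb]; exact h.1
        · rw [Real.le_log_iff_exp_le hc]; exact h.2
      · rw [indicator_of_notMem]
        rintro ⟨h3, h4⟩
        rw [Real.le_log_iff_exp_le hc] at h4
        rw [Real.log_lt_iff_lt_exp hb] at h3
        exact h ⟨h3.le, h4⟩
    exact ⟨h.int.congr h2.symm, e1_nonneg _ _, by rw [integral_congr_ae h2]; exact h.le⟩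

theorem T_IB {b c G : ℝ → ℝ} {C : ℝ} (hb : Continuous b) (hc : Continuous c) (hG : Continuous G)
    (hbc : ∀ w, b w ≤ c w) (hG0 : ∀ w, 0 ≤ G w) (h : IB (fun w => (c w - b w) * G w) C) :
    IB (fun p : ℝ × ℝ => e1 (b p.2) (c p.2) p.1 * G p.2) C := by
  have hm : Measurable (fun p : ℝ × ℝ => e1 (b p.2) (c p.2) p.1 * G p.2) := by
    refine Measurable.mul ?_ (hG.measurable.comp measurable_snd)
    unfold e1
    refine Measurable.ite ?_ (Real.measurable_exp.comp measurable_fst) measurable_const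
    exact (measurableSet_le (hb.measurable.comp measurable_snd)
        (Real.measurable_exp.comp measurable_fst)).inter
      (measurableSet_le (Real.measurable_exp.comp measurable_fst)
        (hc.measurable.comp measurable_snd))
  have h0 : ∀ p : ℝ × ℝ, 0 ≤ e1 (b p.2) (c p.2) p.1 * G p.2 :=
    fun p => mul_nonneg (e1_nonneg _ _ _) (hG0 _)
  have key : ∫⁻ p : ℝ × ℝ, ENNReal.ofReal (e1 (b p.2) (c p.2) p.1 * G p.2)
      ≤ ENNReal.ofReal C := by
    have e : ∫⁻ p : ℝ × ℝ, ENNReal.ofReal (e1 (b p.2) (c p.2) p.1 * G p.2) =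
      ∫⁻ w : ℝ, ∫⁻ v : ℝ, ENNReal.ofReal (e1 (b w) (c w) v * G w) :=
      lintegral_prod_symm _ hm.ennreal_ofReal.aemeasurable
    rw [e]
    calc _ ≤ ∫⁻ w : ℝ, ENNReal.ofReal ((c w - b w) * G w) := by
          refine lintegral_mono fun w => ?_
          have hi := e1_IB (hbc w)
          simp only
          rw [← ofReal_integral_eq_lintegral_ofReal (hi.int.mul_const (G w))
            (Eventually.of_forall fun v => mul_nonneg (e1_nonneg _ _ _) (hG0 _)),
            integral_mul_const]
          exact ENNReal.ofReal_le_ofReal (mul_le_mul_of_nonneg_right hi.le (hG0 w))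
      _ = ENNReal.ofReal (∫ w, (c w - b w) * G w) :=
          (ofReal_integral_eq_lintegral_ofReal h.int (Eventually.of_forall h.nn)).symm
      _ ≤ _ := ENNReal.ofReal_le_ofReal h.le
  refine ⟨⟨hm.aestronglyMeasurable, ?_⟩, h0, ?_⟩
  · rw [hasFiniteIntegral_iff_ofReal (Eventually.of_forall h0)]
    exact key.trans_lt ENNReal.ofReal_lt_top
  · rw [integral_eq_lintegral_of_nonneg_ae (Eventually.of_forall h0) hm.aestronglyMeasurable]
    exact ENNReal.toReal_le_of_le_ofReal h.cnn key

noncomputable def dk (k : ℝ → ℝ → ℝ) (u v w : ℝ) : ℝ :=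
  if v < u ∧ Real.exp u < Real.exp v + Real.exp w then k v w else 0

noncomputable def pk (a u v w : ℝ) : ℝ :=
  if v < u ∧ u < w then Real.exp (-a*v) else 0

structure CH (k : ℝ → ℝ → ℝ) (g : ℝ → ℝ) (a C0 K0 δ m ρ B : ℝ) : Prop where
  kc : Continuous (fun p : ℝ × ℝ => k p.1 p.2)
  k0 : ∀ v w, 0 ≤ k v w
  k1 : ∀ v w, v ≤ w → k v w ≤ C0 * Real.exp (-a*v)
  k2 : ∀ v w, w ≤ v → k v w ≤ C0 * (Real.exp v * Real.exp (-(1+a)*w))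
  k3 : ∀ v w, v ≤ w → |k v w - Real.exp (-a*v)| ≤ K0 * (Real.exp (-(a-δ)*v) * Real.exp (-δ*w))
  k4 : ∀ v w t, k (v-t) (w-t) = Real.exp (a*t) * k v w
  C0p : 0 < C0
  K0p : 0 < K0
  δp : 0 < δ
  δa : δ < a
  m1 : a + 1 < m
  m2 : 3*a < m
  ρp : 0 < ρ
  ρ1 : ρ < 1
  Bp : 0 < B
  gc : Continuous g
  gb : ∀ v, |g v| ≤ B * Ph m ρ v
  gi : ∀ u, g u = ρ * ∫ v : ℝ, ∫ w : ℝ, dk k u v w * (g v * g w)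

variable {k : ℝ → ℝ → ℝ} {g : ℝ → ℝ} {a C0 K0 δ m ρ B : ℝ}

theorem Ph_le_one {q ρ : ℝ} (hq : 0 ≤ q) (hρ : 0 ≤ ρ) (v : ℝ) : Ph q ρ v ≤ 1 := by
  rcases le_total v 0 with hv | hv
  · refine (Ph_le1 _ _ _).trans (Real.exp_le_one_iff.2 (mul_nonpos_of_nonneg_of_nonpos hq hv))
  · refine (Ph_le2 _ _ _).trans (Real.exp_le_one_iff.2 ?_)
    nlinarith [mul_nonneg hρ hv]

theorem CH.a0 (H : CH k g a C0 K0 δ m ρ B) : 0 < a := H.δp.trans H.δa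

theorem CH.kb (H : CH k g a C0 K0 δ m ρ B) (v w : ℝ) :
    k v w ≤ C0 * (Real.exp (-a*v) + Real.exp v * Real.exp (-(1+a)*w)) := by
  have h1 := Real.exp_pos (-a*v)
  have h2 := mul_pos (Real.exp_pos v) (Real.exp_pos (-(1+a)*w))
  rcases le_total v w with h | h
  · exact (H.k1 v w h).trans (mul_le_mul_of_nonneg_left (by linarith) H.C0p.le)
  · exact (H.k2 v w h).trans (mul_le_mul_of_nonneg_left (by linarith) H.C0p.le)

theorem dk_meas (H : CH k g a C0 K0 δ m ρ B) (u : ℝ) :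
    Measurable (fun p : ℝ × ℝ => dk k u p.1 p.2) := by
  unfold dk
  refine Measurable.ite ?_ H.kc.measurable measurable_const
  exact (measurableSet_lt measurable_fst measurable_const).inter
    (measurableSet_lt measurable_const ((Real.measurable_exp.comp measurable_fst).add
      (Real.measurable_exp.comp measurable_snd)))

theorem pk_meas (a u : ℝ) : Measurable (fun p : ℝ × ℝ => pk a u p.1 p.2) := by
  unfold pk
  refine Measurable.ite ?_ (Continuous.measurable (by fun_prop)) measurable_const
  exact (measurableSet_lt measurable_fst measurable_const).inter
    (measurableSet_lt measurable_const measurable_snd)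

theorem CH.gg_meas (H : CH k g a C0 K0 δ m ρ B) :
    Measurable (fun p : ℝ × ℝ => g p.1 * g p.2) :=
  (H.gc.measurable.comp measurable_fst).mul (H.gc.measurable.comp measurable_snd)

theorem CH.IB0 (H : CH k g a C0 K0 δ m ρ B) {q : ℝ} (hq : a < q) :
    IB (fun v => Real.exp (-a*v) * Ph q ρ v) (2 / min (q-a) a) :=
  Ph_IB (lt_min (by linarith) H.a0) (min_le_left _ _)
    ((min_le_right _ _).trans (by linarith [H.ρp]))

theorem CH.IB1 (H : CH k g a C0 K0 δ m ρ B) : IB (fun v => Ph m ρ v) (4 / ρ) := by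
  have := Ph_IB (q := m) (ρ := ρ) (s := 0) (c := ρ/2) (by linarith [H.ρp])
    (by linarith [H.m1, H.a0, H.ρ1, H.ρp]) (by linarith)
  simp only [neg_zero, zero_mul, Real.exp_zero, one_mul] at this
  refine this.weak (le_of_eq ?_)
  have := H.ρp
  field_simp; norm_num

theorem CH.IB2 (H : CH k g a C0 K0 δ m ρ B) :
    IB (fun v => Real.exp (-(1+a)*v) * Ph m ρ v) (2 / min (m-(1+a)) 1) :=
  Ph_IB (lt_min (by linarith [H.m1]) one_pos) (min_le_left _ _)
    ((min_le_right _ _).trans (by linarith [H.ρp, H.a0]))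

theorem CH.ggb (H : CH k g a C0 K0 δ m ρ B) (v w : ℝ) :
    |g v * g w| ≤ B^2 * (Ph m ρ v * Ph m ρ w) := by
  rw [abs_mul]
  calc _ ≤ (B * Ph m ρ v) * (B * Ph m ρ w) :=
        mul_le_mul (H.gb v) (H.gb w) (abs_nonneg _) (mul_nonneg H.Bp.le (Ph_pos _ _ _).le)
    _ = _ := by ring

theorem CH.F_int (H : CH k g a C0 K0 δ m ρ B) (u : ℝ) :
    Integrable (fun p : ℝ × ℝ => dk k u p.1 p.2 * (g p.1 * g p.2)) := by
  have ha := H.a0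
  have h1 := (H.IB0 (q := m) (by linarith [H.m1])).prod H.IB1
  have h2 := (e1_IB (b := 0) (c := Real.exp u) (Real.exp_pos u).le).prod H.IB2
  have h3 := ((h1.add h2).cmul (mul_nonneg H.C0p.le (sq_nonneg B))).int
  refine h3.mono' ((dk_meas H u).mul H.gg_meas).aestronglyMeasurable
    (Eventually.of_forall fun p => ?_)
  obtain ⟨v, w⟩ := p
  have n := ((h1.add h2).cmul (mul_nonneg H.C0p.le (sq_nonneg B))).nn (v,w)
  simp only at n ⊢
  unfold dk
  split_ifs with hd
  · rw [Real.norm_eq_abs, abs_mul, abs_of_nonneg (H.k0 v w)]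
    have e : e1 0 (Real.exp u) v = Real.exp v := by
      unfold e1; rw [if_pos]; exact ⟨(Real.exp_pos v).le, Real.exp_le_exp.2 hd.1.le⟩
    rw [e]
    have P1 := Ph_pos m ρ v
    have P2 := Ph_pos m ρ w
    have P3 := Ph_le_one (q := m) (ρ := ρ) (by linarith [H.m1]) H.ρp.le v
    calc k v w * |g v * g w|
        ≤ (C0 * (Real.exp (-a*v) + Real.exp v * Real.exp (-(1+a)*w)))
          * (B^2 * (Ph m ρ v * Ph m ρ w)) :=
          mul_le_mul (H.kb v w) (H.ggb v w) (abs_nonneg _) ((H.k0 v w).trans (H.kb v w))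
      _ = C0 * B^2 * (Real.exp (-a*v) * Ph m ρ v * Ph m ρ w +
          Ph m ρ v * (Real.exp v * (Real.exp (-(1+a)*w) * Ph m ρ w))) := by ring
      _ ≤ C0 * B^2 * (Real.exp (-a*v) * Ph m ρ v * Ph m ρ w +
          1 * (Real.exp v * (Real.exp (-(1+a)*w) * Ph m ρ w))) := by
          have := H.C0p
          gcongr
      _ = _ := by ring
  · simpa using n

theorem CH.ge (H : CH k g a C0 K0 δ m ρ B) (u : ℝ) :
    g u = ρ * ∫ p : ℝ × ℝ, dk k u p.1 p.2 * (g p.1 * g p.2) := by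
  have : ∫ p : ℝ × ℝ, dk k u p.1 p.2 * (g p.1 * g p.2) =
      ∫ v : ℝ, ∫ w : ℝ, dk k u v w * (g v * g w) := integral_prod _ (H.F_int u)
  rw [this]; exact H.gi u

theorem CH.step1 (H : CH k g a C0 K0 δ m ρ B) {u t : ℝ} (hu : u ≤ 0) (ht : 0 < t) :
    |g u - g (u-t)| ≤ (2*C0*B^2*(4 + 2 / min (m-(1+a)) 1)) * t * Ph (m-a) ρ u := by
  have ha := H.a0
  have hρ := H.ρp
  have hm := H.m1
  set c1 := min (m-(1+a)) 1 with hc1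
  have hc1p : 0 < c1 := lt_min (by linarith) one_pos
  rw [H.ge u, H.ge (u-t), ← mul_sub, ← integral_sub (H.F_int u) (H.F_int (u-t)), abs_mul,
    abs_of_pos hρ]
  have hG := H.IB1.add H.IB2
  rw [← hc1] at hG
  set G : ℝ → ℝ := fun w => Ph m ρ w + Real.exp (-(1+a)*w) * Ph m ρ w with hGdef
  have hGc : Continuous G := by
    have := Ph_cont m ρ
    rw [hGdef]; fun_prop
  have hG0 : ∀ w, 0 ≤ G w := hG.nn
  have hlt : Real.exp (u-t) < Real.exp u := Real.exp_lt_exp.2 (by linarith)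
  have hG' := hG.cmul (sub_nonneg.2 hlt.le)
  have T1 := T_IB (b := fun _ => Real.exp (u-t)) (c := fun _ => Real.exp u) (G := G)
    continuous_const continuous_const hGc (fun _ => hlt.le) hG0 hG'
  have T2 := T_IB (b := fun w => Real.exp (u-t) - Real.exp w)
    (c := fun w => Real.exp u - Real.exp w) (G := G)
    (by fun_prop) (by fun_prop) hGc (fun _ => by linarith) hG0
    (by simpa only [sub_sub_sub_cancel_right] using hG')
  have hcc : 0 ≤ C0 * B^2 * Real.exp ((m-a-1)*u) :=
    mul_nonneg (mul_nonneg H.C0p.le (sq_nonneg B)) (Real.exp_pos _).le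
  have T3 := (T1.add T2).cmul hcc
  have pw : ∀ v w, v ≤ u → |k v w * (g v * g w)| ≤
      C0 * B^2 * Real.exp ((m-a-1)*u) * (Real.exp v * G w) := by
    intro v w hv
    rw [abs_mul, abs_of_nonneg (H.k0 v w)]
    have P2 := Ph_pos m ρ w
    have P3 := Ph_le1 m ρ v
    have E1 : Real.exp (-a*v) * Real.exp (m*v) ≤ Real.exp ((m-a-1)*u) * Real.exp v := by
      rw [← Real.exp_add, ← Real.exp_add]
      refine Real.exp_le_exp.2 ?_
      nlinarith [mul_nonneg (show 0 ≤ m-a-1 by linarith) (sub_nonneg.2 hv)]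
    have E2 : Real.exp (m*v) ≤ Real.exp ((m-a-1)*u) := by
      refine Real.exp_le_exp.2 ?_
      nlinarith [mul_nonneg (show 0 ≤ m-a-1 by linarith) (sub_nonneg.2 hv),
        mul_nonneg (show 0 ≤ a+1 by linarith) (show 0 ≤ -v by linarith)]
    have := H.C0p
    calc k v w * |g v * g w|
        ≤ (C0 * (Real.exp (-a*v) + Real.exp v * Real.exp (-(1+a)*w)))
          * (B^2 * (Ph m ρ v * Ph m ρ w)) :=
          mul_le_mul (H.kb v w) (H.ggb v w) (abs_nonneg _) ((H.k0 v w).trans (H.kb v w))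
      _ ≤ (C0 * (Real.exp (-a*v) + Real.exp v * Real.exp (-(1+a)*w)))
          * (B^2 * (Real.exp (m*v) * Ph m ρ w)) := by gcongr
      _ = C0 * B^2 * ((Real.exp (-a*v) * Real.exp (m*v)) * Ph m ρ w +
          Real.exp (m*v) * (Real.exp v * (Real.exp (-(1+a)*w) * Ph m ρ w))) := by ring
      _ ≤ C0 * B^2 * ((Real.exp ((m-a-1)*u) * Real.exp v) * Ph m ρ w +
          Real.exp ((m-a-1)*u) * (Real.exp v * (Real.exp (-(1+a)*w) * Ph m ρ w))) := by gcongr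
      _ = _ := by rw [hGdef]; ring
  have main := T3.bound (f := fun p : ℝ × ℝ => dk k u p.1 p.2 * (g p.1 * g p.2) -
      dk k (u-t) p.1 p.2 * (g p.1 * g p.2)) (by
    rintro ⟨v, w⟩
    have n := T3.nn (v,w)
    have n1 := e1_nonneg (Real.exp (u-t)) (Real.exp u) v
    have n2 := e1_nonneg (Real.exp (u-t) - Real.exp w) (Real.exp u - Real.exp w) v
    simp only at n ⊢
    unfold dk
    split_ifs with h1 h2 h2
    · simpa using n
    · rw [zero_mul, sub_zero]
      refine (pw v w h1.1.le).trans (mul_le_mul_of_nonneg_left ?_ hcc)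
      have : e1 (Real.exp (u-t)) (Real.exp u) v = Real.exp v := by
        unfold e1; rw [if_pos]
        refine ⟨?_, Real.exp_le_exp.2 h1.1.le⟩
        by_contra hh
        push Not at hh
        exact h2 ⟨Real.exp_lt_exp.1 hh, by linarith [h1.2]⟩
      rw [this]
      linarith [mul_nonneg n2 (hG0 w)]
    · rw [zero_mul, zero_sub, abs_neg]
      have hvu : v ≤ u := by linarith [h2.1]
      refine (pw v w hvu).trans (mul_le_mul_of_nonneg_left ?_ hcc)
      have : e1 (Real.exp (u-t) - Real.exp w) (Real.exp u - Real.exp w) v = Real.exp v := by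
        unfold e1; rw [if_pos]
        refine ⟨by linarith [h2.2], ?_⟩
        by_contra hh
        push Not at hh
        exact h1 ⟨by linarith [h2.1], by linarith⟩
      rw [this]
      linarith [mul_nonneg n1 (hG0 w)]
    · simpa using n)
  have hE : Real.exp u - Real.exp (u-t) ≤ t * Real.exp u := by
    have h := Real.add_one_le_exp (-t)
    have : Real.exp (u-t) = Real.exp u * Real.exp (-t) := by rw [← Real.exp_add]; ring_nf
    rw [this]
    nlinarith [Real.exp_pos u]
  rw [Ph_of_nonpos (by linarith) hρ.le hu]
  have e2 : Real.exp ((m-a)*u) = Real.exp ((m-a-1)*u) * Real.exp u := by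
    rw [← Real.exp_add]; ring_nf
  have hB2 := H.C0p
  have h2c : 0 < 2 / c1 := by positivity
  calc _ ≤ ρ * (C0 * B^2 * Real.exp ((m-a-1)*u) *
        ((Real.exp u - Real.exp (u-t)) * (4/ρ + 2/c1) +
          (Real.exp u - Real.exp (u-t)) * (4/ρ + 2/c1))) :=
        mul_le_mul_of_nonneg_left main hρ.le
    _ ≤ ρ * (C0 * B^2 * Real.exp ((m-a-1)*u) *
        ((t * Real.exp u) * (4/ρ + 2/c1) + (t * Real.exp u) * (4/ρ + 2/c1))) := by gcongr
    _ = 2 * C0 * B^2 * Real.exp ((m-a-1)*u) * (t * Real.exp u) * (4 + ρ * (2/c1)) := by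
        field_simp; ring
    _ ≤ 2 * C0 * B^2 * Real.exp ((m-a-1)*u) * (t * Real.exp u) * (4 + 1 * (2/c1)) := by
        have := H.ρ1.le
        gcongr
    _ = _ := by rw [e2]; ring

noncomputable def ii (x y v : ℝ) : ℝ := if x ≤ v ∧ v ≤ y then 1 else 0

theorem ii_nonneg (x y v : ℝ) : 0 ≤ ii x y v := by
  unfold ii; split_ifs <;> norm_num

theorem ii_IB {x y : ℝ} (h : x ≤ y) : IB (ii x y) (y - x) := by
  have e : ii x y = (Icc x y).indicator (fun _ => (1:ℝ)) := by
    funext v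
    unfold ii
    by_cases hv : x ≤ v ∧ v ≤ y
    · rw [if_pos hv, indicator_of_mem (show v ∈ Icc x y from hv)]
    · rw [if_neg hv, indicator_of_notMem (show v ∉ Icc x y from hv)]
  refine ⟨?_, ii_nonneg _ _, ?_⟩
  · rw [e, integrable_indicator_iff measurableSet_Icc]
    exact continuous_const.integrableOn_Icc
  · rw [e, integral_indicator measurableSet_Icc]
    simp [h]

noncomputable def jj (ρ u w : ℝ) : ℝ := if u < w then Real.exp (-(ρ/2)*w) else 0

theorem jj_nonneg (x y v : ℝ) : 0 ≤ jj x y v := by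
  unfold jj; split_ifs; exacts [(Real.exp_pos _).le, le_rfl]

theorem jj_IB {ρ : ℝ} (hρ : 0 < ρ) (u : ℝ) : IB (jj ρ u) (2/ρ * Real.exp (-(ρ/2)*u)) := by
  have e : jj ρ u = (Ioi u).indicator (fun w => Real.exp (-(ρ/2)*w)) := by
    funext v
    unfold jj
    by_cases hv : u < v
    · rw [if_pos hv, indicator_of_mem (show v ∈ Ioi u from hv)]
    · rw [if_neg hv, indicator_of_notMem (show v ∉ Ioi u from hv)]
  refine ⟨?_, jj_nonneg _ _, ?_⟩
  · rw [e, integrable_indicator_iff measurableSet_Ioi]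
    exact exp_neg_integrableOn_Ioi u (by linarith)
  · rw [e, integral_indicator measurableSet_Ioi, integral_exp_mul_Ioi (by linarith)]
    apply le_of_eq; field_simp

theorem CH.P_int (H : CH k g a C0 K0 δ m ρ B) (u : ℝ) :
    Integrable (fun p : ℝ × ℝ => pk a u p.1 p.2 * (g p.1 * g p.2)) := by
  have ha := H.a0
  have h1 := (H.IB0 (q := m) (by linarith [H.m1])).prod H.IB1
  refine (h1.cmul (sq_nonneg B)).int.mono' ((pk_meas a u).mul H.gg_meas).aestronglyMeasurable
    (Eventually.of_forall fun p => ?_)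
  obtain ⟨v, w⟩ := p
  have n := (h1.cmul (sq_nonneg B)).nn (v,w)
  simp only at n ⊢
  unfold pk
  split_ifs with hd
  · rw [Real.norm_eq_abs, abs_mul, abs_of_pos (Real.exp_pos _)]
    calc _ ≤ Real.exp (-a*v) * (B^2 * (Ph m ρ v * Ph m ρ w)) :=
          mul_le_mul_of_nonneg_left (H.ggb v w) (Real.exp_pos _).le
      _ = _ := by ring
  · simpa using n

theorem CH.gq (H : CH k g a C0 K0 δ m ρ B) (v : ℝ) : |g v| ≤ B * Ph (m-a) ρ v :=
  (H.gb v).trans (mul_le_mul_of_nonneg_left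
    (Ph_mono (by linarith [H.m1]) (by linarith [H.a0]) H.ρp.le v) H.Bp.le)

theorem CH.ggq (H : CH k g a C0 K0 δ m ρ B) (v w : ℝ) :
    |g v * g w| ≤ B^2 * (Ph (m-a) ρ v * Ph (m-a) ρ w) := by
  rw [abs_mul]
  calc _ ≤ (B * Ph (m-a) ρ v) * (B * Ph (m-a) ρ w) :=
        mul_le_mul (H.gq v) (H.gq w) (abs_nonneg _) (mul_nonneg H.Bp.le (Ph_pos _ _ _).le)
    _ = _ := by ring

theorem CH.Pdiff (H : CH k g a C0 K0 δ m ρ B) {u t : ℝ} (ht : 0 < t) (ht1 : t ≤ 1) :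
    |(∫ p : ℝ × ℝ, pk a u p.1 p.2 * (g p.1 * g p.2)) -
      ∫ p : ℝ × ℝ, pk a (u-t) p.1 p.2 * (g p.1 * g p.2)| ≤
    B^2 * (t * (2/ρ * Real.exp (-(ρ/2)*u)) +
      2 / min (m-a-a) a * (Real.exp 1 * Real.exp (-(ρ/2)*u) * t)) := by
  have ha := H.a0
  have hρ := H.ρp
  have hm := H.m2
  rw [← integral_sub (H.P_int u) (H.P_int (u-t))]
  have i1 := ii_IB (x := u-t) (y := u) (by linarith)
  rw [sub_sub_cancel] at i1
  have h1 := i1.prod (jj_IB hρ u)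
  have h2 := (H.IB0 (q := m-a) (by linarith)).prod
    (i1.cmul (mul_pos (Real.exp_pos 1) (Real.exp_pos (-(ρ/2)*u))).le)
  refine ((h1.add h2).cmul (sq_nonneg B)).bound ?_
  rintro ⟨v, w⟩
  have n := ((h1.add h2).cmul (sq_nonneg B)).nn (v,w)
  have n1 := h1.nn (v,w)
  have n2 := h2.nn (v,w)
  have P1 := Ph_pos (m-a) ρ v
  have P2 := Ph_pos (m-a) ρ w
  have pw : |Real.exp (-a*v) * (g v * g w)| ≤
      B^2 * (Real.exp (-a*v) * Ph (m-a) ρ v * Ph (m-a) ρ w) := by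
    rw [abs_mul, abs_of_pos (Real.exp_pos _)]
    calc _ ≤ Real.exp (-a*v) * (B^2 * (Ph (m-a) ρ v * Ph (m-a) ρ w)) :=
          mul_le_mul_of_nonneg_left (H.ggq v w) (Real.exp_pos _).le
      _ = _ := by ring
  simp only at n n1 n2 ⊢
  unfold pk
  split_ifs with h1 h2 h2
  · simpa using n
  · rw [zero_mul, sub_zero]
    refine pw.trans (mul_le_mul_of_nonneg_left ?_ (sq_nonneg B))
    have hi : ii (u-t) u v = 1 := by
      unfold ii; rw [if_pos]
      refine ⟨?_, h1.1.le⟩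
      by_contra hh; push Not at hh
      exact h2 ⟨hh, by linarith [h1.2]⟩
    have hj : jj ρ u w = Real.exp (-(ρ/2)*w) := by unfold jj; rw [if_pos h1.2]
    have hle : Real.exp (-a*v) * Ph (m-a) ρ v ≤ 1 := by
      rcases le_total v 0 with hv | hv
      · refine (mul_le_mul_of_nonneg_left (Ph_le1 _ _ _) (Real.exp_pos _).le).trans ?_
        rw [← Real.exp_add, Real.exp_le_one_iff]
        nlinarith
      · refine (mul_le_mul_of_nonneg_left (Ph_le2 _ _ _) (Real.exp_pos _).le).trans ?_
        rw [← Real.exp_add, Real.exp_le_one_iff]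
        nlinarith
    refine le_trans ?_ (le_add_of_nonneg_right n2)
    rw [hi, hj]
    exact mul_le_mul hle (Ph_le2 _ _ _) P2.le zero_le_one
  · rw [zero_mul, zero_sub, abs_neg]
    refine pw.trans (mul_le_mul_of_nonneg_left ?_ (sq_nonneg B))
    have hwu : w ≤ u := by
      by_contra hh; push Not at hh
      exact h1 ⟨by linarith [h2.1], hh⟩
    have hi : ii (u-t) u w = 1 := by
      unfold ii; rw [if_pos]
      exact ⟨h2.2.le, hwu⟩
    refine le_trans ?_ (le_add_of_nonneg_left n1)
    rw [hi, mul_one]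
    refine mul_le_mul_of_nonneg_left ((Ph_le2 _ _ _).trans ?_)
      (mul_nonneg (Real.exp_pos _).le P1.le)
    rw [← Real.exp_add]
    refine Real.exp_le_exp.2 ?_
    nlinarith [H.ρ1, h2.2, mul_nonneg hρ.le (show 0 ≤ w - (u-1) by linarith [h2.2])]
  · simpa using n

/-- constant for the kernel estimate -/
noncomputable def CK (a C0 K0 δ m : ℝ) : ℝ :=
  K0 * (2 / min (m-a-(a-δ)) (a-δ) * (2/δ)) + C0 * Real.exp 1 * (2 / min (m-a-a) a)
    + C0 * Real.exp 1 * (2 / min (m-a-a) a)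

theorem CH.Kb (H : CH k g a C0 K0 δ m ρ B) {u : ℝ} (hu : 0 ≤ u) :
    ∃ W : ℝ × ℝ → ℝ, IB W (Real.exp (-(ρ/2)*u) * CK a C0 K0 δ m) ∧ ∀ v w,
      |dk k u v w - pk a u v w| * (Ph (m-a) ρ v * Ph (m-a) ρ w) ≤ W (v,w) := by
  have ha := H.a0
  have hρ := H.ρp
  have hρ1 := H.ρ1
  have hm := H.m2
  have hδ := H.δa
  have hδp := H.δp
  have A1 : IB (fun v => Real.exp (-(a-δ)*v) * Ph (m-a) ρ v)
      (2 / min (m-a-(a-δ)) (a-δ)) := Ph_IB (lt_min (by linarith) (by linarith)) (min_le_left _ _)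
    ((min_le_right _ _).trans (by linarith))
  have A2 := A1.prod (IB_abs hδp)
  have i1 := ii_IB (x := u-1) (y := u) (by linarith)
  rw [sub_sub_cancel] at i1
  have A3 := H.IB0 (q := m-a) (by linarith)
  have A4 := A3.prod i1
  rw [mul_one] at A4
  have hPc := Ph_cont (m-a) ρ
  have A5 : IB (fun w => (Real.exp u - (Real.exp u - Real.exp w)) *
      (Real.exp (-(1+a)*w) * Ph (m-a) ρ w)) (2 / min (m-a-a) a) := by
    convert A3 using 2 with w
    rw [sub_sub_cancel, ← mul_assoc, ← Real.exp_add]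
    ring_nf
  have A6 := T_IB (b := fun w => Real.exp u - Real.exp w) (c := fun _ => Real.exp u)
    (G := fun w => Real.exp (-(1+a)*w) * Ph (m-a) ρ w) (by fun_prop) (by fun_prop) (by fun_prop)
    (fun w => by linarith [Real.exp_pos w])
    (fun w => mul_nonneg (Real.exp_pos _).le (Ph_pos _ _ _).le) A5
  have hCe : 0 ≤ C0 * Real.exp 1 := mul_nonneg H.C0p.le (Real.exp_pos 1).le
  have B1 := A2.cmul H.K0p.le
  have B2 := A4.cmul hCe
  have B3 := A6.cmul hCe
  have W := ((B1.add B2).add B3).cmul (Real.exp_pos (-(ρ/2)*u)).le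
  refine ⟨_, W, ?_⟩
  intro v w
  have n := W.nn (v,w)
  have n1 := B1.nn (v,w)
  have n2 := B2.nn (v,w)
  have n3 := B3.nn (v,w)
  have P1 := Ph_pos (m-a) ρ v
  have P2 := Ph_pos (m-a) ρ w
  have C0p := H.C0p
  have K0p := H.K0p
  have near : ∀ x, u - 1 ≤ x → Ph (m-a) ρ x ≤ Real.exp 1 * Real.exp (-(ρ/2)*u) := by
    intro x hx
    refine (Ph_le2 _ _ _).trans ?_
    rw [← Real.exp_add]
    refine Real.exp_le_exp.2 ?_
    nlinarith [mul_nonneg hρ.le (show 0 ≤ x - (u-1) by linarith)]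
  have hexp2 : (2:ℝ) ≤ Real.exp 1 := by linarith [Real.add_one_le_exp 1]
  have hnear : ∀ x, Real.exp u < 2 * Real.exp x → u - 1 ≤ x := by
    intro x hx
    have : Real.exp u < Real.exp (1 + x) := by
      rw [Real.exp_add]; nlinarith [Real.exp_pos x]
    linarith [Real.exp_lt_exp.1 this]
  simp only at n n1 n2 n3 ⊢
  unfold dk pk
  by_cases hv : v < u
  swap
  · rw [if_neg (fun h => hv h.1), if_neg (fun h => hv h.1)]
    simpa using n
  by_cases hw : u < w
  · have hd : Real.exp u < Real.exp v + Real.exp w := by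
      linarith [Real.exp_pos v, Real.exp_lt_exp.2 hw]
    rw [if_pos ⟨hv, hd⟩, if_pos ⟨hv, hw⟩]
    have hw0 : 0 ≤ w := by linarith
    calc _ ≤ (K0 * (Real.exp (-(a-δ)*v) * Real.exp (-δ*w))) *
          (Ph (m-a) ρ v * Real.exp (-(ρ/2)*u)) := by
          refine mul_le_mul (H.k3 v w (by linarith)) (mul_le_mul_of_nonneg_left ?_ P1.le)
            (mul_nonneg P1.le P2.le) (by positivity)
          refine (Ph_le2 _ _ _).trans (Real.exp_le_exp.2 ?_)
          nlinarith
      _ = Real.exp (-(ρ/2)*u) * (K0 * (Real.exp (-(a-δ)*v) * Ph (m-a) ρ v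
            * Real.exp (-δ*|w|))) := by rw [abs_of_nonneg hw0]; ring
      _ ≤ _ := mul_le_mul_of_nonneg_left (by linarith) (Real.exp_pos _).le
  rw [if_neg (c := v < u ∧ u < w) (fun h => hw h.2), sub_zero]
  push Not at hw
  split_ifs with hd
  swap
  · simpa using n
  rw [abs_of_nonneg (H.k0 v w)]
  rcases le_total v w with hvw | hvw
  · have hwn : u - 1 ≤ w := hnear w (by linarith [hd.2, Real.exp_le_exp.2 hvw])
    have hi : ii (u-1) u w = 1 := by unfold ii; rw [if_pos ⟨hwn, hw⟩]
    calc _ ≤ (C0 * Real.exp (-a*v)) *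
          (Ph (m-a) ρ v * (Real.exp 1 * Real.exp (-(ρ/2)*u))) := by
          refine mul_le_mul (H.k1 v w hvw) (mul_le_mul_of_nonneg_left (near w hwn) P1.le)
            (mul_nonneg P1.le P2.le) (by positivity)
      _ = Real.exp (-(ρ/2)*u) * (C0 * Real.exp 1 * (Real.exp (-a*v) * Ph (m-a) ρ v
            * ii (u-1) u w)) := by rw [hi]; ring
      _ ≤ _ := mul_le_mul_of_nonneg_left (by linarith) (Real.exp_pos _).le
  · have hvn : u - 1 ≤ v := hnear v (by linarith [hd.2, Real.exp_le_exp.2 hvw])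
    have hi : e1 (Real.exp u - Real.exp w) (Real.exp u) v = Real.exp v := by
      unfold e1; rw [if_pos ⟨by linarith [hd.2], Real.exp_le_exp.2 hv.le⟩]
    calc _ ≤ (C0 * (Real.exp v * Real.exp (-(1+a)*w))) *
          ((Real.exp 1 * Real.exp (-(ρ/2)*u)) * Ph (m-a) ρ w) := by
          refine mul_le_mul (H.k2 v w hvw) (mul_le_mul_of_nonneg_right (near v hvn) P2.le)
            (mul_nonneg P1.le P2.le) (by positivity)
      _ = Real.exp (-(ρ/2)*u) * (C0 * Real.exp 1 * (e1 (Real.exp u - Real.exp w) (Real.exp u) v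
            * (Real.exp (-(1+a)*w) * Ph (m-a) ρ w))) := by rw [hi]; ring
      _ ≤ _ := mul_le_mul_of_nonneg_left (by linarith) (Real.exp_pos _).le

theorem CH.bracket (H : CH k g a C0 K0 δ m ρ B) {t M : ℝ} (ht : 0 < t) (ht1 : t ≤ 1) (hM : 0 ≤ M)
    (hd : ∀ u, |g u - g (u-t)| ≤ M * t * Ph (m-a) ρ u) (v w : ℝ) :
    |g v * g w - Real.exp (a*t) * (g (v-t) * g (w-t))| ≤
      t * (a * Real.exp a * B^2 * Real.exp 1^2 + B * (1 + Real.exp 1) * M) *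
        (Ph (m-a) ρ v * Ph (m-a) ρ w) := by
  have ha := H.a0
  have hB := H.Bp
  have P1 := Ph_pos (m-a) ρ v
  have P2 := Ph_pos (m-a) ρ w
  have sh : ∀ x, |g (x-t)| ≤ B * (Real.exp 1 * Ph (m-a) ρ x) := fun x =>
    (H.gq _).trans (mul_le_mul_of_nonneg_left
      (Ph_shift (by linarith [H.m1]) H.ρp.le H.ρ1.le ht.le ht1 x) hB.le)
  have hexp : |Real.exp (a*t) - 1| ≤ a * t * Real.exp a := by
    rw [abs_of_nonneg (by linarith [Real.add_one_le_exp (a*t), mul_pos ha ht])]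
    have h1 := Real.add_one_le_exp (-(a*t))
    have h2 : Real.exp (a*t) * Real.exp (-(a*t)) = 1 := by rw [← Real.exp_add]; simp
    have h3 : Real.exp (a*t) ≤ Real.exp a := Real.exp_le_exp.2 (by nlinarith)
    have h4 := Real.exp_pos (a*t)
    nlinarith [mul_le_mul_of_nonneg_left h1 h4.le, mul_pos ha ht,
      mul_le_mul_of_nonneg_left h3 (mul_pos ha ht).le]
  have e : g v * g w - Real.exp (a*t) * (g (v-t) * g (w-t)) =
    g v * (g w - g (w-t)) + (g v - g (v-t)) * g (w-t)
      - (Real.exp (a*t) - 1) * (g (v-t) * g (w-t)) := by ring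
  rw [e]
  refine (abs_sub _ _).trans ((add_le_add_left (abs_add_le _ _) _).trans ?_)
  simp only [abs_mul]
  calc _ ≤ (B * Ph (m-a) ρ v) * (M * t * Ph (m-a) ρ w) +
        (M * t * Ph (m-a) ρ v) * (B * (Real.exp 1 * Ph (m-a) ρ w)) +
        (a * t * Real.exp a) * ((B * (Real.exp 1 * Ph (m-a) ρ v)) *
          (B * (Real.exp 1 * Ph (m-a) ρ w))) := by
        gcongr
        · exact H.gq v
        · exact hd w
        · exact hd v
        · exact sh w
        · exact sh v
        · exact sh w
    _ = _ := by ring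

theorem dkpk_shift (H : CH k g a C0 K0 δ m ρ B) (u t v w : ℝ) :
    dk k (u-t) (v-t) (w-t) - pk a (u-t) (v-t) (w-t) =
      Real.exp (a*t) * (dk k u v w - pk a u v w) := by
  have e1 : (v - t < u - t ∧ Real.exp (u-t) < Real.exp (v-t) + Real.exp (w-t)) ↔
      (v < u ∧ Real.exp u < Real.exp v + Real.exp w) := by
    have : ∀ x, Real.exp (x-t) = Real.exp x * Real.exp (-t) := fun x => by
      rw [← Real.exp_add]; rfl
    rw [this, this, this, ← add_mul, mul_lt_mul_iff_left₀ (Real.exp_pos _), sub_lt_sub_iff_right]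
  have e2 : (v - t < u - t ∧ u - t < w - t) ↔ (v < u ∧ u < w) := by
    rw [sub_lt_sub_iff_right, sub_lt_sub_iff_right]
  unfold dk pk
  simp only [e1, e2, H.k4 v w t]
  have : Real.exp (-a*(v-t)) = Real.exp (a*t) * Real.exp (-a*v) := by
    rw [← Real.exp_add]; ring_nf
  rw [this]
  split_ifs <;> ring

theorem CH.step2 (H : CH k g a C0 K0 δ m ρ B) {t M : ℝ} (ht : 0 < t) (ht1 : t ≤ 1) (hM : 0 ≤ M)
    (hd : ∀ u, |g u - g (u-t)| ≤ M * t * Ph (m-a) ρ u) {u : ℝ} (hu : 0 ≤ u) :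
    |g u - g (u-t)| ≤ ((B^2 * (2 + 2 / min (m-a-a) a * Real.exp 1) +
        a * Real.exp a * B^2 * Real.exp 1^2 * CK a C0 K0 δ m) +
        ρ * (B * (1 + Real.exp 1) * CK a C0 K0 δ m) * M) * t * Ph (m-a) ρ u := by
  have ha := H.a0
  have hρ := H.ρp
  have hm := H.m2
  have hB := H.Bp
  have KI : ∀ u, Integrable (fun p : ℝ × ℝ => (dk k u p.1 p.2 - pk a u p.1 p.2) *
      (g p.1 * g p.2)) := by
    intro u
    refine ((H.F_int u).sub (H.P_int u)).congr (Eventually.of_forall fun p => ?_)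
    simp only [Pi.sub_apply]; ring
  have split : ∀ u, ∫ p : ℝ × ℝ, dk k u p.1 p.2 * (g p.1 * g p.2) =
      (∫ p : ℝ × ℝ, pk a u p.1 p.2 * (g p.1 * g p.2)) +
      ∫ p : ℝ × ℝ, (dk k u p.1 p.2 - pk a u p.1 p.2) * (g p.1 * g p.2) := by
    intro u
    rw [← integral_add (H.P_int u) (KI u)]
    congr 1; funext p; ring
  have tr : (fun p : ℝ × ℝ => (dk k u p.1 p.2 - pk a u p.1 p.2) *
      (Real.exp (a*t) * (g (p.1-t) * g (p.2-t)))) = fun p : ℝ × ℝ =>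
      (fun p : ℝ × ℝ => (dk k (u-t) p.1 p.2 - pk a (u-t) p.1 p.2) * (g p.1 * g p.2))
        (p + (-t,-t)) := by
    funext p
    simp only [Prod.fst_add, Prod.snd_add, ← sub_eq_add_neg]
    rw [dkpk_shift H]; ring
  have KI2 : Integrable (fun p : ℝ × ℝ => (dk k u p.1 p.2 - pk a u p.1 p.2) *
      (Real.exp (a*t) * (g (p.1-t) * g (p.2-t)))) := by
    rw [tr]; exact (KI (u-t)).comp_add_right _
  have trI : ∫ p : ℝ × ℝ, (dk k (u-t) p.1 p.2 - pk a (u-t) p.1 p.2) * (g p.1 * g p.2) =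
      ∫ p : ℝ × ℝ, (dk k u p.1 p.2 - pk a u p.1 p.2) *
      (Real.exp (a*t) * (g (p.1-t) * g (p.2-t))) := by
    rw [tr]; exact (integral_add_right_eq_self (μ := (volume : Measure (ℝ × ℝ))) _ _).symm
  obtain ⟨W, hW, hWb⟩ := H.Kb hu
  set Q := a * Real.exp a * B^2 * Real.exp 1^2 + B * (1 + Real.exp 1) * M with hQ
  have hQ0 : 0 ≤ t * Q := by positivity
  have Kd : |(∫ p : ℝ × ℝ, (dk k u p.1 p.2 - pk a u p.1 p.2) * (g p.1 * g p.2)) -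
      ∫ p : ℝ × ℝ, (dk k (u-t) p.1 p.2 - pk a (u-t) p.1 p.2) * (g p.1 * g p.2)| ≤
      t * Q * (Real.exp (-(ρ/2)*u) * CK a C0 K0 δ m) := by
    rw [trI, ← integral_sub (KI u) KI2]
    refine (hW.cmul hQ0).bound ?_
    rintro ⟨v, w⟩
    simp only
    rw [← mul_sub, abs_mul]
    calc _ ≤ |dk k u v w - pk a u v w| * (t * Q * (Ph (m-a) ρ v * Ph (m-a) ρ w)) :=
          mul_le_mul_of_nonneg_left (H.bracket ht ht1 hM hd v w) (abs_nonneg _)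
      _ = t * Q * (|dk k u v w - pk a u v w| * (Ph (m-a) ρ v * Ph (m-a) ρ w)) := by ring
      _ ≤ _ := mul_le_mul_of_nonneg_left (hWb v w) hQ0
  have Pd := H.Pdiff (u := u) ht ht1
  have CKn : 0 ≤ CK a C0 K0 δ m := by
    have := hW.cnn
    exact nonneg_of_mul_nonneg_right this (Real.exp_pos _)
  rw [Ph_of_nonneg (by linarith) hρ.le hu]
  have : |g u - g (u-t)| ≤ ρ * (B^2 * (t * (2/ρ * Real.exp (-(ρ/2)*u)) +
      2 / min (m-a-a) a * (Real.exp 1 * Real.exp (-(ρ/2)*u) * t)) +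
      t * Q * (Real.exp (-(ρ/2)*u) * CK a C0 K0 δ m)) := by
    rw [H.ge u, H.ge (u-t), ← mul_sub, abs_mul, abs_of_pos hρ]
    refine mul_le_mul_of_nonneg_left ?_ hρ.le
    rw [split u, split (u-t), add_sub_add_comm]
    exact (abs_add_le _ _).trans (add_le_add Pd Kd)
  refine this.trans ?_
  set E := Real.exp (-(ρ/2)*u)
  have hE : 0 < E := Real.exp_pos _
  set c := 2 / min (m-a-a) a
  have hc : 0 ≤ c := (div_pos two_pos (lt_min (by linarith) ha)).le
  have e : ρ * (B^2 * (t * (2/ρ * E) + c * (Real.exp 1 * E * t)) + t * Q * (E * CK a C0 K0 δ m))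
    = (B^2 * (2 + ρ * (c * Real.exp 1)) +
        ρ * (a * Real.exp a * B^2 * Real.exp 1^2 * CK a C0 K0 δ m) +
        ρ * (B * (1 + Real.exp 1) * CK a C0 K0 δ m) * M) * t * E := by
    rw [hQ]; field_simp; ring
  rw [e]
  have x1 : ρ * (c * Real.exp 1) ≤ 1 * (c * Real.exp 1) :=
    mul_le_mul_of_nonneg_right H.ρ1.le (by positivity)
  have x2 : ρ * (a * Real.exp a * B^2 * Real.exp 1^2 * CK a C0 K0 δ m) ≤
      1 * (a * Real.exp a * B^2 * Real.exp 1^2 * CK a C0 K0 δ m) :=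
    mul_le_mul_of_nonneg_right H.ρ1.le (by positivity)
  rw [one_mul] at x1 x2
  gcongr

/-- constants of the final estimate -/
noncomputable def CA (a C0 K0 δ m B : ℝ) : ℝ :=
  2*C0*B^2*(4 + 2 / min (m-(1+a)) 1) + (B^2 * (2 + 2 / min (m-a-a) a * Real.exp 1) +
        a * Real.exp a * B^2 * Real.exp 1^2 * CK a C0 K0 δ m)

noncomputable def CB (a C0 K0 δ m B : ℝ) : ℝ := B * (1 + Real.exp 1) * CK a C0 K0 δ m

theorem CK_nonneg {a C0 K0 δ m : ℝ} (h1 : 0 < C0) (h2 : 0 < K0) (h3 : 0 < δ) (h4 : δ < a)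
    (h5 : 3*a < m) : 0 ≤ CK a C0 K0 δ m := by
  have p1 : 0 < min (m-a-(a-δ)) (a-δ) := lt_min (by linarith) (by linarith)
  have p2 : 0 < min (m-a-a) a := lt_min (by linarith) (by linarith)
  unfold CK; positivity

theorem CA_pos {a C0 K0 δ m B : ℝ} (h1 : 0 < C0) (h2 : 0 < K0) (h3 : 0 < δ) (h4 : δ < a)
    (h5 : 3*a < m) (h6 : a + 1 < m) (hB : 0 < B) : 0 < CA a C0 K0 δ m B := by
  have p1 : 0 < min (m-(1+a)) 1 := lt_min (by linarith) (by linarith)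
  have p2 : 0 < min (m-a-a) a := lt_min (by linarith) (by linarith)
  have := CK_nonneg h1 h2 h3 h4 h5
  have ha : 0 < a := h3.trans h4
  unfold CA; positivity

theorem CH.main (H : CH k g a C0 K0 δ m ρ B) (hs : ρ * CB a C0 K0 δ m B ≤ 1/2) {t : ℝ}
    (ht : 0 < t) (ht1 : t ≤ 1) (u : ℝ) :
    |g u - g (u-t)| ≤ 2 * CA a C0 K0 δ m B * t * Ph (m-a) ρ u := by
  have ha := H.a0
  have hρ := H.ρp
  have hB := H.Bp
  have hA := CA_pos H.C0p H.K0p H.δp H.δa H.m2 H.m1 hB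
  have hCK := CK_nonneg H.C0p H.K0p H.δp H.δa H.m2
  set A := CA a C0 K0 δ m B with hAd
  have hm1 := H.m1
  have hm2 := H.m2
  have C0p := H.C0p
  have p1 : 0 < min (m-(1+a)) 1 := lt_min (by linarith) (by linarith)
  have p2 : 0 < min (m-a-a) a := lt_min (by linarith) (by linarith)
  have t1 : 0 ≤ 2*C0*B^2*(4 + 2 / min (m-(1+a)) 1) := by positivity
  have t2 : 0 ≤ B^2 * (2 + 2 / min (m-a-a) a * Real.exp 1) +
        a * Real.exp a * B^2 * Real.exp 1^2 * CK a C0 K0 δ m := by positivity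
  have boot : ∀ M, 0 ≤ M → (∀ u, |g u - g (u-t)| ≤ M * t * Ph (m-a) ρ u) →
      ∀ u, |g u - g (u-t)| ≤ (A + M/2) * t * Ph (m-a) ρ u := by
    intro M hM hd u
    have P := Ph_pos (m-a) ρ u
    rcases le_total u 0 with hu | hu
    · refine (H.step1 hu ht).trans ?_
      have : 2*C0*B^2*(4 + 2 / min (m-(1+a)) 1) ≤ A + M/2 := by
        rw [hAd]; unfold CA; linarith
      gcongr
    · refine (H.step2 ht ht1 hM hd hu).trans ?_
      have h3 := mul_le_mul_of_nonneg_right hs hM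
      unfold CB at h3
      have : (B^2 * (2 + 2 / min (m-a-a) a * Real.exp 1) +
        a * Real.exp a * B^2 * Real.exp 1^2 * CK a C0 K0 δ m) +
        ρ * (B * (1 + Real.exp 1) * CK a C0 K0 δ m) * M ≤ A + M/2 := by
        rw [hAd]; unfold CA; linarith
      gcongr
  obtain ⟨M0, hM0, hbase⟩ : ∃ M0, 0 ≤ M0 ∧ ∀ u, |g u - g (u-t)| ≤ M0 * t * Ph (m-a) ρ u := by
    refine ⟨B * (1 + Real.exp 1) / t, by positivity, fun u => ?_⟩
    have h1 := H.gq u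
    have h2 := (H.gq (u-t)).trans (mul_le_mul_of_nonneg_left
      (Ph_shift (by linarith [H.m1]) H.ρp.le H.ρ1.le ht.le ht1 u) hB.le)
    rw [div_mul_cancel₀ _ ht.ne']
    refine (abs_sub _ _).trans ?_
    linarith
  have iter : ∀ n : ℕ, ∀ u, |g u - g (u-t)| ≤ (2*A + M0 * (1/2)^n) * t * Ph (m-a) ρ u := by
    intro n
    induction n with
    | zero =>
      intro u
      refine (hbase u).trans ?_
      have P := Ph_pos (m-a) ρ u
      gcongr
      simp; exact hA.le
    | succ n ih =>
      intro u
      refine (boot _ (by positivity) ih u).trans (le_of_eq ?_)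
      ring
  have lim : Tendsto (fun n : ℕ => (2*A + M0 * (1/2:ℝ)^n) * t * Ph (m-a) ρ u) atTop
      (nhds ((2*A + M0 * 0) * t * Ph (m-a) ρ u)) := by
    refine Tendsto.mul_const _ (Tendsto.mul_const _ (Tendsto.const_add _ (Tendsto.const_mul _ ?_)))
    exact tendsto_pow_atTop_nhds_zero_of_lt_one (by norm_num) (by norm_num)
  have := ge_of_tendsto' lim (fun n => iter n u)
  simpa using this

theorem sub_Iio {ρ : ℝ} (hρ : 0 < ρ) (u : ℝ) (f : ℝ → ℝ) :
    ∫ y in Iio (ρ*u), f y = ρ * ∫ v in Iio u, f (ρ*v) := by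
  rw [← integral_indicator measurableSet_Iio, ← integral_indicator measurableSet_Iio]
  have := Measure.integral_comp_mul_left ((Iio (ρ*u)).indicator f) ρ
  have e : (fun x => (Iio (ρ*u)).indicator f (ρ*x)) = (Iio u).indicator (fun v => f (ρ*v)) := by
    funext x
    simp only [indicator, mem_Iio, mul_lt_mul_iff_right₀ hρ]
  rw [e] at this
  rw [this, abs_of_pos (inv_pos.2 hρ), smul_eq_mul, ← mul_assoc, mul_inv_cancel₀ hρ.ne', one_mul]

theorem sub_Ioi {ρ : ℝ} (hρ : 0 < ρ) (u : ℝ) (f : ℝ → ℝ) :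
    ∫ y in Ioi (ρ*u), f y = ρ * ∫ v in Ioi u, f (ρ*v) := by
  rw [← integral_indicator measurableSet_Ioi, ← integral_indicator measurableSet_Ioi]
  have := Measure.integral_comp_mul_left ((Ioi (ρ*u)).indicator f) ρ
  have e : (fun x => (Ioi (ρ*u)).indicator f (ρ*x)) = (Ioi u).indicator (fun v => f (ρ*v)) := by
    funext x
    simp only [indicator, mem_Ioi, mul_lt_mul_iff_right₀ hρ]
  rw [e] at this
  rw [this, abs_of_pos (inv_pos.2 hρ), smul_eq_mul, ← mul_assoc, mul_inv_cancel₀ hρ.ne', one_mul]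

theorem gi_of_solves {K : ℝ → ℝ → ℝ} {a ρ : ℝ} {h : ℝ → ℝ} (hρ : 0 < ρ) (hs : solvesE K a ρ h)
    (u : ℝ) : h (ρ*u) = ρ * ∫ v : ℝ, ∫ w : ℝ,
      dk (fun v w => Real.exp (-a*w) * K (Real.exp (v-w)) 1) u v w * (h (ρ*v) * h (ρ*w)) := by
  rw [hs (ρ*u), sub_Iio hρ, ← mul_assoc, one_div, inv_mul_cancel₀ hρ.ne', one_mul,
    ← integral_indicator measurableSet_Iio, ← integral_const_mul]
  congr 1; funext v
  by_cases hv : v < u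
  swap
  · rw [indicator_of_notMem (by simpa using hv)]
    have : ∀ w, dk (fun v w => Real.exp (-a*w) * K (Real.exp (v-w)) 1) u v w = 0 := by
      intro w; unfold dk; rw [if_neg (fun hh => hv hh.1)]
    simp only [this, zero_mul, integral_zero, mul_zero]
  rw [indicator_of_mem (show v ∈ Iio u from hv)]
  have e : ρ*u + ρ * Real.log (1 - Real.exp ((ρ*v - ρ*u)/ρ)) =
      ρ * (u + Real.log (1 - Real.exp (v-u))) := by
    have : (ρ*v - ρ*u)/ρ = v - u := by field_simp
    rw [this]; ring
  rw [e, sub_Ioi hρ, ← integral_indicator measurableSet_Ioi]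
  congr 2; funext w
  have p1 : 0 < 1 - Real.exp (v-u) := by
    have : Real.exp (v-u) < 1 := by rw [← Real.exp_zero]; exact Real.exp_lt_exp.2 (by linarith)
    linarith
  have iff1 : u + Real.log (1 - Real.exp (v-u)) < w ↔
      Real.exp u < Real.exp v + Real.exp w := by
    rw [← Real.exp_lt_exp, Real.exp_add, Real.exp_log p1, mul_sub, ← Real.exp_add]
    have : u + (v-u) = v := by ring
    rw [this]
    constructor <;> intro <;> linarith
  unfold dk
  by_cases hw : Real.exp u < Real.exp v + Real.exp w
  · rw [indicator_of_mem (show w ∈ Ioi _ from iff1.2 hw), if_pos ⟨hv, hw⟩]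
    have e1 : -(a/ρ)*(ρ*w) = -a*w := by field_simp
    have e2 : (ρ*v - ρ*w)/ρ = v - w := by field_simp
    rw [e1, e2]; ring
  · rw [indicator_of_notMem (show w ∉ Ioi _ from fun h => hw (iff1.1 h)),
      if_neg (fun hh => hw hh.2), zero_mul]

theorem mkCH {K : ℝ → ℝ → ℝ} {γ a K0 δ m L ρ : ℝ} {h : ℝ → ℝ} (hK : KernelHyp K γ a K0 δ)
    (hm1 : a + 1 < m) (hm2 : 3*a < m) (hL : 0 < L) (hρ : 0 < ρ) (hρ1 : ρ < 1)
    (hX : memX a m L ρ h) (hc : Continuous h) (hs : solvesE K a ρ h) :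
    CH (fun v w => Real.exp (-a*w) * K (Real.exp (v-w)) 1) (fun v => h (ρ*v)) a (1+K0) K0 δ m ρ
      (2 * Real.exp (m*L + L/2)) := by
  obtain ⟨hγ, haγ, hKc, hKn, hKs, hKh, hK0, hδ, hKa⟩ := hK
  have hδ0 := hδ.1
  have hδ2 : δ < a := hδ.2.trans_le (min_le_right _ _)
  have ha : 0 < a := hδ0.trans hδ2
  have k3 : ∀ v w, v ≤ w → |Real.exp (-a*w) * K (Real.exp (v-w)) 1 - Real.exp (-a*v)| ≤
      K0 * (Real.exp (-(a-δ)*v) * Real.exp (-δ*w)) := by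
    intro v w hvw
    have hx : Real.exp (v-w) ∈ Ioo (0:ℝ) 2 :=
      ⟨Real.exp_pos _, by
        have : Real.exp (v-w) ≤ 1 := Real.exp_le_one_iff.2 (by linarith)
        linarith⟩
    have h1 := hKa _ hx
    rw [← Real.exp_mul, ← Real.exp_mul] at h1
    have e : Real.exp (-a*w) * K (Real.exp (v-w)) 1 - Real.exp (-a*v) =
        Real.exp (-a*v) * (Real.exp ((v-w)*a) * K (Real.exp (v-w)) 1 - 1) := by
      have : Real.exp (-a*w) = Real.exp (-a*v) * Real.exp ((v-w)*a) := by
        rw [← Real.exp_add]; ring_nf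
      rw [this]; ring
    have e2 : Real.exp (-(a-δ)*v) * Real.exp (-δ*w) = Real.exp (-a*v) * Real.exp ((v-w)*δ) := by
      rw [← Real.exp_add, ← Real.exp_add]; ring_nf
    rw [e, e2, abs_mul, abs_of_pos (Real.exp_pos _)]
    calc _ ≤ Real.exp (-a*v) * (K0 * Real.exp ((v-w)*δ)) :=
          mul_le_mul_of_nonneg_left h1 (Real.exp_pos _).le
      _ = _ := by ring
  have k1 : ∀ v w, v ≤ w → Real.exp (-a*w) * K (Real.exp (v-w)) 1 ≤
      (1+K0) * Real.exp (-a*v) := by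
    intro v w hvw
    have h1 := (abs_le.1 (k3 v w hvw)).2
    have : Real.exp (-(a-δ)*v) * Real.exp (-δ*w) ≤ Real.exp (-a*v) := by
      rw [← Real.exp_add]
      refine Real.exp_le_exp.2 ?_
      nlinarith
    nlinarith [mul_le_mul_of_nonneg_left this hK0.le]
  refine ⟨?_, ?_, k1, ?_, k3, ?_, by linarith, hK0, hδ0, hδ2, hm1, hm2, hρ, hρ1, by positivity,
    by fun_prop, ?_, gi_of_solves hρ hs⟩
  · refine Continuous.mul (by fun_prop) ?_
    exact hKc.comp_continuous (f := fun p : ℝ × ℝ => (Real.exp (p.1-p.2), (1:ℝ))) (by fun_prop)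
      (fun p => mk_mem_prod (mem_Ioi.2 (Real.exp_pos _)) (mem_Ioi.2 one_pos))
  · intro v w
    exact mul_nonneg (Real.exp_pos _).le (hKn _ _ (Real.exp_pos _) one_pos)
  · intro v w hwv
    have h1 := k1 w v hwv
    have e1 : K (Real.exp (v-w)) 1 = Real.exp (γ*(v-w)) * K (Real.exp (w-v)) 1 := by
      have := hKh 1 (Real.exp (w-v)) (Real.exp (v-w)) one_pos (Real.exp_pos _) (Real.exp_pos _)
      rw [mul_one, ← Real.exp_add, ← Real.exp_mul] at this
      have z : v - w + (w - v) = 0 := by ring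
      rw [z, Real.exp_zero] at this
      rw [this, hKs 1 _ one_pos (Real.exp_pos _), mul_comm γ]
    have e2 : Real.exp (-a*w) * K (Real.exp (v-w)) 1 =
        Real.exp (v-w) * (Real.exp (-a*v) * K (Real.exp (w-v)) 1) := by
      rw [e1, ← mul_assoc, ← mul_assoc, ← Real.exp_add, ← Real.exp_add]
      congr 2
      have : γ = 1 - a := by linarith
      rw [this]; ring
    rw [e2]
    calc _ ≤ Real.exp (v-w) * ((1+K0) * Real.exp (-a*w)) :=
          mul_le_mul_of_nonneg_left h1 (Real.exp_pos _).le
      _ = (1+K0) * (Real.exp (v-w) * Real.exp (-a*w)) := by ring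
      _ = _ := by rw [← Real.exp_add, ← Real.exp_add]; ring_nf
  · intro v w t
    have e1 : v - t - (w - t) = v - w := by ring
    have e2 : Real.exp (-a*(w-t)) = Real.exp (a*t) * Real.exp (-a*w) := by
      rw [← Real.exp_add]; ring_nf
    rw [e1, e2]; ring
  · intro v
    refine (hX.2.2.2 (ρ*v)).trans ?_
    rw [mul_assoc]
    refine mul_le_mul_of_nonneg_left ?_ (by norm_num)
    have hmp : 0 < m := by linarith
    have mL : 0 < m*L := mul_pos hmp hL
    unfold omegaFn
    split_ifs with h1 h2
    · have hv : v ≤ -L := by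
        by_contra hh; push Not at hh
        nlinarith
      rw [Ph_of_nonpos hmp.le hρ.le (by linarith), ← Real.exp_add]
      refine Real.exp_le_exp.2 ?_
      have : m/ρ*(ρ*v+L*ρ) = m*(v+L) := by field_simp
      rw [this]; linarith
    · have hv1 : -L < v := by
        by_contra hh; push Not at hh
        exact h1 (by nlinarith)
      have hv2 : v < L := by
        by_contra hh; push Not at hh
        nlinarith
      unfold Ph
      rw [mul_min_of_nonneg _ _ (Real.exp_pos _).le, ← Real.exp_add, ← Real.exp_add]
      refine le_min (Real.exp_le_exp.2 ?_) (Real.exp_le_exp.2 ?_)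
      · nlinarith [mul_pos hmp (show 0 < v + L by linarith)]
      · nlinarith [mul_pos hρ (show 0 < L - v by linarith)]
    · have hv2 : L ≤ v := by
        by_contra hh; push Not at hh
        exact h2 (by nlinarith)
      rw [Ph_of_nonneg hmp.le hρ.le (by linarith), ← Real.exp_add]
      refine Real.exp_le_exp.2 ?_
      nlinarith

end Aux

/-- bound on the difference quotients of the solution
(Lemma 6.1 of the paper). -/
theorem difference_quotient_bound
    (K : ℝ → ℝ → ℝ) (γ a K0 δ m L0 ρ0 : ℝ)
    (hK : KernelHyp K γ a K0 δ) (hP : ParamHyp a m L0 ρ0) :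
    ∀ L : ℝ, L0 ≤ L → ∃ A : ℝ, 0 < A ∧ ∃ ρbar ∈ Ioo (0:ℝ) ρ0,
      ∀ ρ ∈ Ioo (0:ℝ) ρbar, ∀ h : ℝ → ℝ, memX a m L ρ h →
      Continuous h → solvesE K a ρ h →
      (∀ y : ℝ, y < L*ρ → Qfun K a ρ h y ∈ Icc (1/2:ℝ) (3/2)) →
      (∀ x : ℝ, |h x| ≤ 2 * Real.exp (lamFn K a L ρ h x)) →
      ∀ τ ∈ Ioo (0:ℝ) ρ, ∀ x : ℝ, L*ρ ≤ x →
        |(h x - h (x - τ))/τ| ≤ (A/ρ) * Real.exp (-(1/2)*(x - L*ρ)) := by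
  intro L hL
  obtain ⟨hm, hL0, hρ0⟩ := hP
  have hK' := hK
  obtain ⟨hγ, haγ, hKc, hKn, hKs, hKh, hK0, hδ, hKa⟩ := hK'
  have hδ0 := hδ.1
  have hδ2 : δ < a := hδ.2.trans_le (min_le_right _ _)
  have ha : 0 < a := hδ0.trans hδ2
  have hm1 : a + 1 < m := (le_max_left _ _).trans_lt hm
  have hm2 : 3*a < m := (le_max_right _ _).trans_lt hm
  have hLp : 0 < L := by
    have : 0 < (1/a) * Real.log (4*m) :=
      mul_pos (by positivity) (Real.log_pos (by linarith))
    linarith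
  set B := 2 * Real.exp (m*L + L/2) with hB
  have hBp : 0 < B := by positivity
  have hA := CA_pos (B := B) (show 0 < 1 + K0 by linarith) hK0 hδ0 hδ2 hm2 hm1 hBp
  have hCB : 0 ≤ CB a (1+K0) K0 δ m B := by
    have := CK_nonneg (show 0 < 1 + K0 by linarith) hK0 hδ0 hδ2 hm2
    unfold CB; positivity
  have hden : 0 < 2 * CB a (1+K0) K0 δ m B + 1 := by linarith
  refine ⟨2 * CA a (1+K0) K0 δ m B, by linarith,
    min (ρ0/2) (1/(2 * CB a (1+K0) K0 δ m B + 1)),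
    ⟨lt_min (by linarith [hρ0.1]) (by positivity),
      (min_le_left _ _).trans_lt (by linarith [hρ0.1])⟩, ?_⟩
  intro ρ hρ h hX hc hs _ _ τ hτ x hx
  have hρp := hρ.1
  have hρ1 : ρ < 1 := by
    have := hρ.2.trans_le (min_le_left _ _)
    linarith [hρ0.1, hρ0.2]
  have hsm : ρ * CB a (1+K0) K0 δ m B ≤ 1/2 := by
    have := hρ.2.trans_le (min_le_right _ _)
    rw [lt_div_iff₀ hden] at this
    nlinarith
  have H := mkCH hK hm1 hm2 hLp hρp hρ1 hX hc hs
  have ht : 0 < τ/ρ := div_pos hτ.1 hρp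
  have ht1 : τ/ρ ≤ 1 := by rw [div_le_one hρp]; exact hτ.2.le
  have key := H.main hsm ht ht1 (x/ρ)
  have e1 : ρ * (x/ρ) = x := by field_simp
  have e2 : ρ * (x/ρ - τ/ρ) = x - τ := by field_simp
  simp only [e1, e2] at key
  rw [abs_div, abs_of_pos hτ.1, div_le_iff₀ hτ.1]
  refine key.trans ?_
  have e3 : Ph (m-a) ρ (x/ρ) ≤ Real.exp (-(1/2)*(x - L*ρ)) := by
    refine (Ph_le2 _ _ _).trans (Real.exp_le_exp.2 ?_)
    have : -(ρ/2)*(x/ρ) = -(1/2)*x := by field_simp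
    rw [this]
    nlinarith [mul_pos hLp hρp]
  calc _ ≤ 2 * CA a (1+K0) K0 δ m B * (τ/ρ) * Real.exp (-(1/2)*(x - L*ρ)) := by gcongr
    _ = _ := by ring
end
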